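/- Assume sp < n. Let μ be a Borel measure with finite total mass, g ∈ W^{s,p}_loc(ℝⁿ) ∩ L^{p−1}_{sp}(ℝⁿ), and let u be a SOLA of the Dirichlet problem −L_Φ u = μ in Ω, u = g on ℝⁿ∖Ω. Then u belongs to the local Marcinkiewicz space M^{n(p−1)/(n−sp)}_loc(Ω): for every open subset Ω′ compactly contained in Ω, sup_{λ ≥ 0} λ^{n(p−1)/(n−sp)} |{x ∈ Ω′ : |u(x)| > λ}| < ∞. -/

import Mathlib

noncomputable section

open MeasureTheory Metric Set Filter Topology
open scoped ENNReal NNReal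

/-- Euclidean space `ℝⁿ`. -/
abbrev Rn (n : ℕ) : Type := EuclideanSpace ℝ (Fin n)

/-- `q_* = max {1, p-1}`. -/
def qStar (p : ℝ) : ℝ := max 1 (p - 1)

/-- `q̄ = min {n(p-1)/(n-s), p}`. -/
def qBar (n : ℕ) (s p : ℝ) : ℝ := min ((n : ℝ) * (p - 1) / ((n : ℝ) - s)) p

/-- Gagliardo seminorm raised to the power `p`, as an `ℝ≥0∞`-valued double integral. -/
def gagliardo (n : ℕ) (s p : ℝ) (O : Set (Rn n)) (v : Rn n → ℝ) : ℝ≥0∞ :=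
  ∫⁻ x in O, ∫⁻ y in O, ENNReal.ofReal (|v x - v y| ^ p / ‖x - y‖ ^ ((n : ℝ) + s * p))

/-- `v ∈ W^{s,p}(O)`. -/
def memWsp (n : ℕ) (s p : ℝ) (O : Set (Rn n)) (v : Rn n → ℝ) : Prop :=
  AEMeasurable v (volume.restrict O) ∧
    (∫⁻ x in O, ENNReal.ofReal (|v x| ^ p)) < ⊤ ∧ gagliardo n s p O v < ⊤

/-- `Tail(v; x₀, r)`. -/
def tailFn (n : ℕ) (s p : ℝ) (v : Rn n → ℝ) (x₀ : Rn n) (r : ℝ) : ℝ≥0∞ :=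
  (ENNReal.ofReal (r ^ (s * p)) *
      ∫⁻ x in (ball x₀ r)ᶜ,
        ENNReal.ofReal (|v x| ^ (p - 1) / ‖x - x₀‖ ^ ((n : ℝ) + s * p))) ^ (1 / (p - 1))

/-- `v ∈ L^{p-1}_{sp}(ℝⁿ)`. -/
def memTailSpace (n : ℕ) (s p : ℝ) (v : Rn n → ℝ) : Prop :=
  AEMeasurable v (volume : Measure (Rn n)) ∧
    (∀ R : ℝ, (∫⁻ x in ball (0 : Rn n) R, ENNReal.ofReal (|v x| ^ (p - 1))) < ⊤) ∧
    ∀ z : Rn n, ∀ r : ℝ, 0 < r → tailFn n s p v z r < ⊤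

/-- `φ ∈ C_0^∞(O)`. -/
def IsTestFun (n : ℕ) (O : Set (Rn n)) (φ : Rn n → ℝ) : Prop :=
  ContDiff ℝ (⊤ : ℕ∞) φ ∧ HasCompactSupport φ ∧ tsupport φ ⊆ O

/-- The nonlocal form `⟨-L_Φ u, φ⟩`. -/
def nonlocalForm (n : ℕ) (Φ : ℝ → ℝ) (K : Rn n → Rn n → ℝ) (u φ : Rn n → ℝ) : ℝ :=
  ∫ x : Rn n, ∫ y : Rn n, Φ (u x - u y) * (φ x - φ y) * K x y

/-- Ellipticity/coercivity bounds on the kernel `K`. -/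
def KernelBounds (n : ℕ) (Λ s p : ℝ) (K : Rn n → Rn n → ℝ) : Prop :=
  Measurable (Function.uncurry K) ∧
    ∀ x y : Rn n, x ≠ y →
      1 / (Λ * ‖x - y‖ ^ ((n : ℝ) + s * p)) ≤ K x y ∧
        K x y ≤ Λ / ‖x - y‖ ^ ((n : ℝ) + s * p)

/-- Structure conditions on `Φ`. -/
def PhiBounds (Λ p : ℝ) (Φ : ℝ → ℝ) : Prop :=
  Continuous Φ ∧ Φ 0 = 0 ∧
    ∀ t : ℝ, |t| ^ p / Λ ≤ Φ t * t ∧ Φ t * t ≤ Λ * |t| ^ p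

/-- `∫ φ dμ` for a signed measure `μ`. -/
def sintegral (n : ℕ) (μ : MeasureTheory.SignedMeasure (Rn n)) (φ : Rn n → ℝ) : ℝ :=
  (∫ x, φ x ∂μ.toJordanDecomposition.posPart) -
    ∫ x, φ x ∂μ.toJordanDecomposition.negPart

/-- Weak (energy) solution of `-L_Φ u = f` in `Ω`, `u = g` on `ℝⁿ ∖ Ω`. -/
def WeakSol (n : ℕ) (Φ : ℝ → ℝ) (K : Rn n → Rn n → ℝ) (s p : ℝ)
    (Ω : Set (Rn n)) (f g u : Rn n → ℝ) : Prop :=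
  memWsp n s p univ u ∧ (∀ᵐ x : Rn n, x ∉ Ω → u x = g x) ∧
    ∀ φ : Rn n → ℝ, IsTestFun n Ω φ → nonlocalForm n Φ K u φ = ∫ x : Rn n, φ x * f x

/-- Weak subsolution of the homogeneous equation `-L_Φ w = 0` in `Ω`. -/
def WeakSubSol (n : ℕ) (Φ : ℝ → ℝ) (K : Rn n → Rn n → ℝ) (s p : ℝ)
    (Ω : Set (Rn n)) (w : Rn n → ℝ) : Prop :=
  memWsp n s p univ w ∧
    ∀ φ : Rn n → ℝ, IsTestFun n Ω φ → (∀ x, 0 ≤ φ x) → nonlocalForm n Φ K w φ ≤ 0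

/-- The approximation properties required of a SOLA. -/
def SOLAApprox (n : ℕ) (Φ : ℝ → ℝ) (K : Rn n → Rn n → ℝ) (s p : ℝ)
    (Ω : Set (Rn n)) (μ : MeasureTheory.SignedMeasure (Rn n)) (g u : Rn n → ℝ)
    (uj μj gj : ℕ → Rn n → ℝ) : Prop :=
  (∀ j, ContDiff ℝ (⊤ : ℕ∞) (μj j) ∧ HasCompactSupport (μj j)) ∧
  (∀ j, ContDiff ℝ (⊤ : ℕ∞) (gj j) ∧ HasCompactSupport (gj j)) ∧
  (∀ j, WeakSol n Φ K s p Ω (μj j) (gj j) (uj j)) ∧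
  (∀ᵐ x : Rn n, Tendsto (fun j => uj j x) atTop (𝓝 (u x))) ∧
  (∀ q : ℝ, qStar p ≤ q → q < qBar n s p → ∀ z : Rn n, ∀ r : ℝ, 0 < r →
    Tendsto (fun j => ∫⁻ x in ball z r, ENNReal.ofReal (|uj j x - u x| ^ q)) atTop (𝓝 0)) ∧
  (∀ φ : Rn n → ℝ, Continuous φ → HasCompactSupport φ → tsupport φ ⊆ Ω →
    Tendsto (fun j => ∫ x : Rn n, φ x * μj j x) atTop (𝓝 (sintegral n μ φ))) ∧
  (∀ z : Rn n, ∀ r : ℝ, 0 < r →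
    Filter.limsup (fun j => ∫⁻ x in ball z r, ENNReal.ofReal |μj j x|) atTop
      ≤ μ.totalVariation (closedBall z r)) ∧
  (∀ z : Rn n, ∀ r : ℝ, 0 < r →
    Tendsto (fun j =>
        (∫⁻ x in ball z r, ENNReal.ofReal (|gj j x - g x| ^ p)) +
          gagliardo n s p (ball z r) (fun x => gj j x - g x)) atTop (𝓝 0) ∧
      Tendsto (fun j => tailFn n s p (fun x => gj j x - g x) z r) atTop (𝓝 0))

/-- SOLA of the Dirichlet problem `-L_Φ u = μ` in `Ω`, `u = g` on `ℝⁿ ∖ Ω`. -/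
def IsSOLA (n : ℕ) (Φ : ℝ → ℝ) (K : Rn n → Rn n → ℝ) (s p : ℝ)
    (Ω : Set (Rn n)) (μ : MeasureTheory.SignedMeasure (Rn n)) (g u : Rn n → ℝ) : Prop :=
  (∀ h q : ℝ, 0 < h → h < s → qStar p ≤ q → q < qBar n s p → memWsp n h q Ω u) ∧
  (∀ φ : Rn n → ℝ, IsTestFun n Ω φ → nonlocalForm n Φ K u φ = sintegral n μ φ) ∧
  (∀ᵐ x : Rn n, x ∉ Ω → u x = g x) ∧
  ∃ uj μj gj : ℕ → Rn n → ℝ, SOLAApprox n Φ K s p Ω μ g u uj μj gj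

/-- Truncated Wolff potential `W^ν_{s,p}(x₀, r)`. -/
def wolff (n : ℕ) (s p : ℝ) (ν : Measure (Rn n)) (x₀ : Rn n) (r : ℝ) : ℝ≥0∞ :=
  ∫⁻ ρ in Ioc (0 : ℝ) r,
    (ν (ball x₀ ρ) / ENNReal.ofReal (ρ ^ ((n : ℝ) - s * p))) ^ (1 / (p - 1)) /
      ENNReal.ofReal ρ

/-- Integral average of `u` over `B_r(x₀)`. -/
def ballAvg (n : ℕ) (u : Rn n → ℝ) (x₀ : Rn n) (r : ℝ) : ℝ :=
  ⨍ x in ball x₀ r, u x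

/-- Local excess `A(f; x₀, r)`. -/
def locExcess (n : ℕ) (p : ℝ) (f : Rn n → ℝ) (x₀ : Rn n) (r : ℝ) : ℝ≥0∞ :=
  ((volume (ball x₀ r))⁻¹ *
      ∫⁻ x in ball x₀ r, ENNReal.ofReal (|f x - ballAvg n f x₀ r| ^ qStar p)) ^ (1 / qStar p)

/-- Global excess `E(f; x₀, r)`. -/
def excess (n : ℕ) (s p : ℝ) (f : Rn n → ℝ) (x₀ : Rn n) (r : ℝ) : ℝ≥0∞ :=
  locExcess n p f x₀ r + tailFn n s p (fun x => f x - ballAvg n f x₀ r) x₀ r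

/-- `g ∈ W^{s,p}_loc(ℝⁿ) ∩ L^{p-1}_{sp}(ℝⁿ)`. -/
def BoundaryDatum (n : ℕ) (s p : ℝ) (g : Rn n → ℝ) : Prop :=
  (∀ z : Rn n, ∀ r : ℝ, 0 < r → memWsp n s p (ball z r) g) ∧ memTailSpace n s p g

/-- Symmetric measurable kernel with ellipticity bounds. -/
def SymKernel (n : ℕ) (Λ s p : ℝ) (Kt : Rn n → Rn n → ℝ) : Prop :=
  KernelBounds n Λ s p Kt ∧ ∀ x y : Rn n, Kt x y = Kt y x

/-- Weak solution of the kernel-`Kt` fractional `p`-Laplace equation with datum `f` in `O`. -/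
def WeakSolP (n : ℕ) (Kt : Rn n → Rn n → ℝ) (s p : ℝ) (O : Set (Rn n))
    (f u : Rn n → ℝ) : Prop :=
  memWsp n s p univ u ∧
    ∀ φ : Rn n → ℝ, IsTestFun n O φ →
      (∫ x : Rn n, ∫ y : Rn n,
          |u x - u y| ^ (p - 2) * (u x - u y) * (φ x - φ y) * Kt x y) =
        ∫ x : Rn n, φ x * f x

namespace Marcinkiewicz

theorem rpow_sub_one_mul_self {t p : ℝ} (ht : 0 ≤ t) (hp : 1 < p) :
    t ^ (p - 1) * t = t ^ p := by
  rcases ht.eq_or_lt with rfl | h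
  · rw [mul_zero, Real.zero_rpow (by linarith)]
  · rw [Real.rpow_sub_one h.ne', div_mul_cancel₀ _ h.ne']

theorem rpow_mul_le_add {a b ε p : ℝ} (ha : 0 ≤ a) (hb : 0 ≤ b) (hε : 0 < ε) (hp : 1 < p) :
    a ^ (p - 1) * b ≤ ε * a ^ p + ε ^ (-(p - 1)) * b ^ p := by
  rcases le_total b (ε * a) with h | h
  · calc a ^ (p - 1) * b ≤ a ^ (p - 1) * (ε * a) := by gcongr
      _ = ε * a ^ p := by rw [← rpow_sub_one_mul_self ha hp]; ring
      _ ≤ _ := le_add_of_nonneg_right (by positivity)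
  · have h1 : a ≤ ε⁻¹ * b := by
      rw [inv_mul_eq_div, le_div_iff₀ hε]; linarith
    calc a ^ (p - 1) * b ≤ (ε⁻¹ * b) ^ (p - 1) * b := by
          gcongr
      _ = ε ^ (-(p - 1)) * b ^ p := by
          rw [Real.mul_rpow (by positivity) hb, ← rpow_sub_one_mul_self hb hp,
            Real.inv_rpow hε.le, Real.rpow_neg hε.le]; ring
      _ ≤ _ := le_add_of_nonneg_left (by positivity)

theorem abs_add_rpow_le (a b : ℝ) {r : ℝ} (hr : 0 ≤ r) :
    |a + b| ^ r ≤ 2 ^ r * (|a| ^ r + |b| ^ r) := by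
  wlog h : |a| ≤ |b| generalizing a b
  · rw [add_comm a, add_comm (|a| ^ r)]
    exact this b a (le_of_not_ge h)
  calc |a + b| ^ r ≤ (2 * |b|) ^ r := by
        gcongr; exact (abs_add_le a b).trans (by linarith)
    _ = 2 ^ r * |b| ^ r := Real.mul_rpow (by norm_num) (abs_nonneg _)
    _ ≤ _ := by gcongr; exact le_add_of_nonneg_left (by positivity)

theorem abs_sub_rpow_le (a b : ℝ) {r : ℝ} (hr : 0 ≤ r) :
    |a - b| ^ r ≤ 2 ^ r * (|a| ^ r + |b| ^ r) := by
  simpa [sub_eq_add_neg] using abs_add_rpow_le a (-b) hr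

theorem rpow_sub_rpow_le {a b p : ℝ} (ha : 0 ≤ a) (hb : 0 ≤ b) (hp : 1 < p) :
    |a ^ p - b ^ p| ≤ p * (|a - b| * max a b ^ (p - 1)) := by
  wlog h : b ≤ a generalizing a b
  · rw [abs_sub_comm, abs_sub_comm a, max_comm]
    exact this hb ha (le_of_not_ge h)
  rw [max_eq_left h, abs_of_nonneg (sub_nonneg.2 h),
    abs_of_nonneg (sub_nonneg.2 (Real.rpow_le_rpow hb h (by linarith)))]
  rcases ha.eq_or_lt with rfl | ha
  · obtain rfl : b = 0 := le_antisymm h hb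
    simp
  have h1 := one_add_mul_self_le_rpow_one_add (s := b / a - 1)
    (by have : 0 ≤ b / a := by positivity
        linarith) hp.le
  rw [add_sub_cancel, Real.div_rpow hb ha.le, le_div_iff₀ (by positivity)] at h1
  have h2 : a ^ (p - 1) = a ^ p / a := Real.rpow_sub_one ha.ne' p
  have h3 : (1 + p * (b / a - 1)) * a ^ p = a ^ p - p * ((a - b) * a ^ (p - 1)) := by
    rw [h2]; field_simp; ring
  linarith

theorem weighted_young {a m d M ε p σ : ℝ} (ha : 0 ≤ a) (hm : 0 ≤ m) (hd : 0 ≤ d) (hM : 0 < M)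
    (hε : 0 < ε) (hp : 1 < p) :
    a ^ (p - 1) * (d * m ^ (p - 1)) ≤
      ε * (m ^ p * (a ^ p * M ^ (-σ))) + ε ^ (-(p - 1)) * (d ^ p * M ^ (σ * (p - 1))) := by
  have hp0 : p ≠ 0 := by linarith
  have h := rpow_mul_le_add (a := m * a * M ^ (-σ / p)) (b := d * M ^ (σ * (p - 1) / p))
    (by positivity) (by positivity) hε hp
  have e1 : (m * a * M ^ (-σ / p)) ^ (p - 1) * (d * M ^ (σ * (p - 1) / p)) =
      a ^ (p - 1) * (d * m ^ (p - 1)) := by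
    rw [Real.mul_rpow (by positivity) (by positivity), Real.mul_rpow hm ha, ← Real.rpow_mul hM.le]
    have : M ^ (-σ / p * (p - 1)) * M ^ (σ * (p - 1) / p) = 1 := by
      rw [← Real.rpow_add hM, show -σ / p * (p - 1) + σ * (p - 1) / p = 0 by ring, Real.rpow_zero]
    linear_combination (m ^ (p - 1) * a ^ (p - 1) * d) * this
  have e2 : (m * a * M ^ (-σ / p)) ^ p = m ^ p * (a ^ p * M ^ (-σ)) := by
    rw [Real.mul_rpow (by positivity) (by positivity), Real.mul_rpow hm ha, ← Real.rpow_mul hM.le,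
      div_mul_cancel₀ _ hp0, mul_assoc]
  have e3 : (d * M ^ (σ * (p - 1) / p)) ^ p = d ^ p * M ^ (σ * (p - 1)) := by
    rw [Real.mul_rpow hd (by positivity), ← Real.rpow_mul hM.le, div_mul_cancel₀ _ hp0]
  rwa [e1, e2, e3] at h

/-- A bounded increasing function with derivative of order `(1 + |t|) ^ (-(1 + δ))`. -/
def satur (δ t : ℝ) : ℝ := if 0 ≤ t then 1 - (1 + t) ^ (-δ) else (1 - t) ^ (-δ) - 1

theorem satur_of_nonneg {δ t : ℝ} (ht : 0 ≤ t) : satur δ t = 1 - (1 + t) ^ (-δ) := if_pos ht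

theorem satur_zero (δ : ℝ) : satur δ 0 = 0 := by simp [satur]

theorem satur_neg (δ t : ℝ) : satur δ (-t) = -satur δ t := by
  rcases lt_trichotomy t 0 with h | rfl | h
  · simp [satur, h.le, not_le.2 h, sub_eq_add_neg]
  · simp [satur_zero]
  · simp [satur, h.le, not_le.2 h]

theorem one_sub_mul_le_rpow_neg {t δ : ℝ} (ht : 0 < t) (h : 0 ≤ δ) :
    1 - δ * (t - 1) ≤ t ^ (-δ) := by
  rw [Real.rpow_def_of_pos ht]
  have h1 := Real.add_one_le_exp (Real.log t * -δ)
  have h2 := mul_le_mul_of_nonneg_left (Real.log_le_sub_one_of_pos ht) h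
  linarith

theorem le_satur_sub {δ a b : ℝ} (hδ : 0 < δ) (hb : 0 ≤ b) (hab : b ≤ a) :
    δ * ((a - b) * (1 + a) ^ (-(1 + δ))) ≤ satur δ a - satur δ b := by
  have ha := hb.trans hab
  rw [satur_of_nonneg ha, satur_of_nonneg hb]
  have h1 := one_sub_mul_le_rpow_neg (t := (1 + b) / (1 + a)) (by positivity) hδ.le
  rw [Real.div_rpow (by positivity) (by positivity), le_div_iff₀ (by positivity)] at h1
  have h2 : (1 + a) ^ (-(1 + δ)) = (1 + a) ^ (-δ) / (1 + a) := by
    rw [← Real.rpow_sub_one (by positivity)]; congr 1; ring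
  have h3 : (1 - δ * ((1 + b) / (1 + a) - 1)) * (1 + a) ^ (-δ) =
      (1 + a) ^ (-δ) + δ * ((a - b) * (1 + a) ^ (-(1 + δ))) := by
    rw [h2]; field_simp; ring
  linarith

theorem satur_sub_le {δ a b : ℝ} (hδ : 0 < δ) (hδ1 : δ ≤ 1) (hb : 0 ≤ b) (hab : b ≤ a) :
    satur δ a - satur δ b ≤ a - b := by
  have ha := hb.trans hab
  rw [satur_of_nonneg ha, satur_of_nonneg hb]
  have h1 := one_sub_mul_le_rpow_neg (t := (1 + a) / (1 + b)) (by positivity) hδ.le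
  rw [Real.div_rpow (by positivity) (by positivity), le_div_iff₀ (by positivity)] at h1
  have h4 : (1 + b) ^ (-δ) ≤ 1 :=
    Real.rpow_le_one_of_one_le_of_nonpos (by linarith) (by linarith)
  have h5 : (1 + a) / (1 + b) - 1 = (a - b) / (1 + b) := by field_simp; ring
  have h6 : (a - b) / (1 + b) ≤ a - b := div_le_self (by linarith) (by linarith)
  have h7 : 0 ≤ (a - b) / (1 + b) := div_nonneg (by linarith) (by linarith)
  have h8 : 0 ≤ (1 + b) ^ (-δ) := by positivity
  rw [h5] at h1
  have h9 : δ * ((a - b) / (1 + b)) * (1 + b) ^ (-δ) ≤ 1 * (a - b) * 1 := by gcongr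
  linarith

theorem abs_satur_le {δ t : ℝ} (hδ : 0 < δ) : |satur δ t| ≤ 1 := by
  wlog h : 0 ≤ t generalizing t
  · rw [← abs_neg, ← satur_neg]
    exact this (by linarith)
  rw [satur_of_nonneg h]
  have h4 : (1 + t) ^ (-δ) ≤ 1 :=
    Real.rpow_le_one_of_one_le_of_nonpos (by linarith) (by linarith)
  have h8 : 0 ≤ (1 + t) ^ (-δ) := by positivity
  rw [abs_le]; constructor <;> linarith

theorem satur_sub_bounds {δ a b : ℝ} (hδ : 0 < δ) (hδ1 : δ ≤ 1) (hab : b ≤ a) :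
    δ * ((a - b) * (1 + |a| + |b|) ^ (-(1 + δ))) ≤ satur δ a - satur δ b ∧
      satur δ a - satur δ b ≤ a - b := by
  have hmono : ∀ x y : ℝ, 0 < x → x ≤ y → y ^ (-(1 + δ)) ≤ x ^ (-(1 + δ)) := fun x y hx hxy =>
    Real.rpow_le_rpow_of_nonpos hx hxy (by linarith)
  have key : ∀ a b : ℝ, 0 ≤ b → b ≤ a →
      δ * ((a - b) * (1 + |a| + |b|) ^ (-(1 + δ))) ≤ satur δ a - satur δ b := fun a b hb hab => by
    refine le_trans ?_ (le_satur_sub hδ hb hab)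
    have := hmono (1 + a) (1 + |a| + |b|) (by linarith)
      (by rw [abs_of_nonneg hb, abs_of_nonneg (hb.trans hab)]; linarith)
    have h : 0 ≤ a - b := by linarith
    gcongr
  rcases le_total 0 b with hb | hb
  · exact ⟨key a b hb hab, satur_sub_le hδ hδ1 hb hab⟩
  rcases le_total 0 a with ha | ha
  · have k1 := key a 0 le_rfl ha
    have k2 := key (-b) 0 le_rfl (by linarith)
    have l1 := satur_sub_le hδ hδ1 le_rfl ha
    have l2 := satur_sub_le hδ hδ1 le_rfl (neg_nonneg.2 hb)
    simp only [satur_neg, satur_zero, abs_neg, abs_zero, sub_zero, add_zero] at k1 k2 l1 l2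
    refine ⟨?_, by linarith⟩
    have m1 := hmono (1 + |a|) (1 + |a| + |b|) (by positivity)
      (by linarith [abs_nonneg b])
    have m2 := hmono (1 + |b|) (1 + |a| + |b|) (by positivity)
      (by linarith [abs_nonneg a])
    have m3 := mul_le_mul_of_nonneg_left (mul_le_mul_of_nonneg_left m1 ha) hδ.le
    have m4 := mul_le_mul_of_nonneg_left (mul_le_mul_of_nonneg_left m2 (neg_nonneg.2 hb)) hδ.le
    linarith
  · have k1 := key (-b) (-a) (by linarith) (by linarith)
    have l1 := satur_sub_le hδ hδ1 (neg_nonneg.2 ha) (neg_le_neg hab)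
    simp only [satur_neg, abs_neg] at k1 l1
    refine ⟨?_, by linarith⟩
    rw [add_right_comm]
    convert k1 using 1 <;> ring_nf

theorem monotone_satur {δ : ℝ} (hδ : 0 < δ) (hδ1 : δ ≤ 1) : Monotone (satur δ) := fun b a hab => by
  have h := (satur_sub_bounds hδ hδ1 hab).1
  have : 0 ≤ δ * ((a - b) * (1 + |a| + |b|) ^ (-(1 + δ))) :=
    mul_nonneg hδ.le (mul_nonneg (sub_nonneg.2 hab) (by positivity))
  linarith

theorem abs_satur_sub_le {δ : ℝ} (hδ : 0 < δ) (hδ1 : δ ≤ 1) (a b : ℝ) :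
    |satur δ a - satur δ b| ≤ |a - b| := by
  wlog h : b ≤ a generalizing a b
  · rw [abs_sub_comm, abs_sub_comm a]; exact this b a (le_of_not_ge h)
  rw [abs_of_nonneg (sub_nonneg.2 h), abs_of_nonneg (sub_nonneg.2 (monotone_satur hδ hδ1 h))]
  exact (satur_sub_bounds hδ hδ1 h).2

theorem le_abs_satur_sub {δ : ℝ} (hδ : 0 < δ) (hδ1 : δ ≤ 1) (a b : ℝ) :
    δ * (|a - b| * (1 + |a| + |b|) ^ (-(1 + δ))) ≤ |satur δ a - satur δ b| := by
  wlog h : b ≤ a generalizing a b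
  · rw [abs_sub_comm, abs_sub_comm (satur δ a), add_right_comm]; exact this b a (le_of_not_ge h)
  rw [abs_of_nonneg (sub_nonneg.2 h), abs_of_nonneg (sub_nonneg.2 (monotone_satur hδ hδ1 h))]
  exact (satur_sub_bounds hδ hδ1 h).1

/-- Truncation of `t` at height `k`. -/
def trunc (k t : ℝ) : ℝ := max (-k) (min k t)

theorem abs_trunc_le {k : ℝ} (hk : 0 ≤ k) (t : ℝ) : |trunc k t| ≤ k :=
  abs_le.2 ⟨le_max_left _ _, max_le (by linarith) (min_le_left _ _)⟩

theorem monotone_trunc (k : ℝ) : Monotone (trunc k) := fun _ _ h =>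
  max_le_max le_rfl (min_le_min le_rfl h)

theorem abs_trunc_sub_le (k a b : ℝ) : |trunc k a - trunc k b| ≤ |a - b| :=
  (abs_max_sub_max_le_abs _ _ (-k)).trans' (by rw [trunc, trunc, max_comm, max_comm (-k)]) |>.trans
    (by simpa [min_comm] using abs_min_sub_min_le_max k a k b)

theorem trunc_zero {k : ℝ} (hk : 0 ≤ k) : trunc k 0 = 0 := by simp [trunc, hk]

theorem half_le_abs_trunc_sub {k a b : ℝ} (hk : 0 ≤ k) (ha : k < |a|) (hb : |b| ≤ k / 2) :
    k / 2 ≤ |trunc k a - trunc k b| := by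
  have hb' := abs_le.1 hb
  have h1 : trunc k b = b := by
    rw [trunc, min_eq_right (by linarith), max_eq_right (by linarith)]
  rcases lt_abs.1 ha with h | h
  · rw [h1, trunc, min_eq_left h.le, max_eq_right (by linarith)]
    exact le_abs.2 (Or.inl (by linarith))
  · rw [h1, trunc, min_eq_right (by linarith), max_eq_left (by linarith)]
    exact le_abs.2 (Or.inr (by linarith))

theorem integrable_min_rpow_div (n : ℕ) (hn : 2 ≤ n) {s p L : ℝ} (hs : 0 < s) (hs1 : s < 1)
    (hp : 1 < p) (hL : 0 ≤ L) :
    Integrable (fun w : Rn n => min (L * ‖w‖ ^ p) 1 / ‖w‖ ^ ((n : ℝ) + s * p)) := by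
  have : Nontrivial (Rn n) := by
    have : Nonempty (Fin n) := ⟨⟨0, by omega⟩⟩
    infer_instance
  have key : IntegrableOn (fun y : ℝ => y ^ (n - 1) • (min (L * y ^ p) 1 / y ^ ((n : ℝ) + s * p)))
      (Ioi 0) := by
    have hmeas : Measurable fun y : ℝ =>
        y ^ (n - 1) • (min (L * y ^ p) 1 / y ^ ((n : ℝ) + s * p)) := by
      fun_prop
    have hpow : ∀ y : ℝ, 0 < y → y ^ (n - 1) = y ^ ((n : ℝ) - 1) := fun y hy => by
      rw [← Real.rpow_natCast, Nat.cast_sub (by omega), Nat.cast_one]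
    rw [← Ioc_union_Ioi_eq_Ioi zero_le_one, integrableOn_union]
    constructor
    · have h1 : IntegrableOn (fun y : ℝ => L * y ^ (p * (1 - s) - 1)) (Ioc 0 1) := by
        refine Integrable.const_mul ?_ L
        have := intervalIntegral.intervalIntegrable_rpow' (a := 0) (b := 1) (r := p * (1 - s) - 1)
          (by nlinarith)
        exact (intervalIntegrable_iff_integrableOn_Ioc_of_le zero_le_one).1 this
      refine h1.mono' hmeas.aestronglyMeasurable
        ((ae_restrict_iff' measurableSet_Ioc).2 (.of_forall fun y hy => ?_))
      have hy0 := hy.1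
      rw [Real.norm_of_nonneg (by positivity), smul_eq_mul, hpow y hy0]
      calc y ^ ((n : ℝ) - 1) * (min (L * y ^ p) 1 / y ^ ((n : ℝ) + s * p))
          ≤ y ^ ((n : ℝ) - 1) * ((L * y ^ p) / y ^ ((n : ℝ) + s * p)) := by
            gcongr; exact min_le_left _ _
        _ = L * (y ^ ((n : ℝ) - 1) * y ^ p / y ^ ((n : ℝ) + s * p)) := by ring
        _ = _ := by
          rw [← Real.rpow_add hy0, ← Real.rpow_sub hy0]; ring_nf
    · have h1 : IntegrableOn (fun y : ℝ => y ^ (-1 - s * p)) (Ioi 1) :=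
        integrableOn_Ioi_rpow_of_lt (by nlinarith) zero_lt_one
      refine h1.mono' hmeas.aestronglyMeasurable
        ((ae_restrict_iff' measurableSet_Ioi).2 (.of_forall fun y hy => ?_))
      have hy0 : 0 < y := zero_lt_one.trans hy
      rw [Real.norm_of_nonneg (by positivity), smul_eq_mul, hpow y hy0]
      calc y ^ ((n : ℝ) - 1) * (min (L * y ^ p) 1 / y ^ ((n : ℝ) + s * p))
          ≤ y ^ ((n : ℝ) - 1) * (1 / y ^ ((n : ℝ) + s * p)) := by
            gcongr; exact min_le_right _ _
        _ = y ^ ((n : ℝ) - 1) / y ^ ((n : ℝ) + s * p) := by ring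
        _ = _ := by rw [← Real.rpow_sub hy0]; ring_nf
  exact (integrable_fun_norm_addHaar (volume : Measure (Rn n))
    (f := fun y => min (L * y ^ p) 1 / y ^ ((n : ℝ) + s * p))).2
    (by simpa using key)

theorem lintegral_cutoff_le (n : ℕ) (hn : 2 ≤ n) {s p : ℝ} (hs : 0 < s) (hs1 : s < 1)
    (hp : 1 < p) {L : ℝ≥0} {ζ : Rn n → ℝ} (hζ : LipschitzWith L ζ) (h0 : ∀ x, 0 ≤ ζ x)
    (h1 : ∀ x, ζ x ≤ 1) :
    ∃ C : ℝ≥0∞, C < ⊤ ∧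
      ∀ x, ∫⁻ y, ENNReal.ofReal (|ζ x - ζ y| ^ p / ‖x - y‖ ^ ((n : ℝ) + s * p)) ≤ C := by
  have hint := integrable_min_rpow_div n hn (L := (L : ℝ) ^ p) hs hs1 hp (by positivity)
  refine ⟨_, hint.lintegral_lt_top, fun x => ?_⟩
  rw [← lintegral_sub_left_eq_self (μ := volume) (fun w : Rn n =>
    ENNReal.ofReal (min ((L : ℝ) ^ p * ‖w‖ ^ p) 1 / ‖w‖ ^ ((n : ℝ) + s * p))) x]
  refine lintegral_mono fun y => ENNReal.ofReal_le_ofReal ?_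
  refine div_le_div_of_nonneg_right ?_ (by positivity)
  refine le_min ?_ (Real.rpow_le_one (abs_nonneg _) ?_ (by linarith))
  · rw [← Real.mul_rpow (by positivity) (by positivity)]
    gcongr
    simpa [Real.dist_eq, dist_eq_norm] using hζ.dist_le_mul x y
  · rw [abs_le]; constructor <;> linarith [h0 x, h1 x, h0 y, h1 y]

theorem lintegral_compl_ball_lt_top (n : ℕ) (hn : 2 ≤ n) {s p R : ℝ} (hs : 0 < s) (hs1 : s < 1)
    (hp : 1 < p) (hR : 0 < R) (z : Rn n) :
    ∫⁻ y in (ball z R)ᶜ, ENNReal.ofReal (1 / ‖y - z‖ ^ ((n : ℝ) + s * p)) < ⊤ := by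
  have hint := integrable_min_rpow_div n hn (L := R ^ (-p)) hs hs1 hp (by positivity)
  refine lt_of_le_of_lt ?_ hint.lintegral_lt_top
  rw [← lintegral_sub_right_eq_self (μ := volume)
    (fun w : Rn n => ENNReal.ofReal (min (R ^ (-p) * ‖w‖ ^ p) 1 / ‖w‖ ^ ((n : ℝ) + s * p))) z]
  refine (setLIntegral_mono' measurableSet_ball.compl fun y hy => ?_).trans
    (setLIntegral_le_lintegral _ _)
  have hy' : R ≤ ‖y - z‖ := by simpa [dist_eq_norm] using hy
  refine ENNReal.ofReal_le_ofReal ?_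
  refine div_le_div_of_nonneg_right ?_ (by positivity)
  refine le_min ?_ le_rfl
  rw [Real.rpow_neg hR.le, inv_mul_eq_div, le_div_iff₀ (by positivity), one_mul]
  gcongr

theorem le_volume_ball_inter_ball {n : ℕ} (hn : 2 ≤ n) {x z : Rn n} {r ρ : ℝ} (hr : 0 < r)
    (hrρ : r ≤ 2 * ρ) (hx : x ∈ ball z ρ) :
    ENNReal.ofReal ((r / 2) ^ n) * volume (ball (0 : Rn n) 1) ≤ volume (ball z ρ ∩ ball x r) := by
  have hρ : 0 < ρ := by linarith
  have : Nontrivial (Rn n) := by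
    have : Nonempty (Fin n) := ⟨⟨0, by omega⟩⟩
    infer_instance
  set t : ℝ := r / (2 * ρ)
  have ht0 : 0 < t := by positivity
  have ht1 : t ≤ 1 := (div_le_one (by positivity)).2 hrρ
  have htρ : t * ρ = r / 2 := by simp only [t]; field_simp
  rw [mem_ball, dist_eq_norm] at hx
  set x' : Rn n := x + t • (z - x)
  have e1 : x' - z = (1 - t) • (x - z) := by simp only [x']; module
  have e2 : x' - x = -(t • (x - z)) := by simp only [x']; module
  have h1 : dist x' z ≤ ρ - r / 2 := by
    rw [dist_eq_norm, e1, norm_smul, Real.norm_of_nonneg (by linarith), ← htρ]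
    nlinarith
  have h2 : dist x' x ≤ r / 2 := by
    rw [dist_eq_norm, e2, norm_neg, norm_smul, Real.norm_of_nonneg ht0.le, ← htρ]
    gcongr
  have hsub : ball x' (r / 2) ⊆ ball z ρ ∩ ball x r :=
    subset_inter (ball_subset_ball' (by linarith)) (ball_subset_ball' (by linarith))
  refine le_trans (le_of_eq ?_) (measure_mono hsub)
  rw [Measure.addHaar_ball _ x' (by positivity), finrank_euclideanSpace_fin]

theorem le_lintegral_ball_diff {n : ℕ} (hn : 2 ≤ n) {N : ℝ} (hN : 0 ≤ N) {x z : Rn n} {r ρ : ℝ}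
    (hr : 0 < r) (hrρ : r ≤ 2 * ρ) (hx : x ∈ ball z ρ) {A : Set (Rn n)} (hA : MeasurableSet A)
    (hAtop : volume A ≠ ⊤)
    (h2 : 2 * volume A ≤ ENNReal.ofReal ((r / 2) ^ n) * volume (ball (0 : Rn n) 1)) :
    ENNReal.ofReal (1 / r ^ N) * volume A ≤
      ∫⁻ y in ball z ρ \ A, ENNReal.ofReal (1 / ‖x - y‖ ^ N) := by
  have : Nontrivial (Rn n) := by
    have : Nonempty (Fin n) := ⟨⟨0, by omega⟩⟩
    infer_instance
  set S : Set (Rn n) := (ball z ρ ∩ ball x r) \ A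
  have hSm : MeasurableSet S := (measurableSet_ball.inter measurableSet_ball).diff hA
  have hS : volume A ≤ volume S := by
    have h3 := h2.trans (le_volume_ball_inter_ball hn hr hrρ hx)
    have h4 : volume (ball z ρ ∩ ball x r) ≤ volume S + volume A :=
      (measure_mono (by intro y hy; by_cases h : y ∈ A <;> simp [S, h, hy.1, hy.2])).trans
        (measure_union_le S A)
    rw [two_mul] at h3
    exact (ENNReal.add_le_add_iff_right hAtop).1 (h3.trans h4)
  calc ENNReal.ofReal (1 / r ^ N) * volume A ≤ ENNReal.ofReal (1 / r ^ N) * volume S := by gcongr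
    _ = ∫⁻ y in S, ENNReal.ofReal (1 / r ^ N) := by rw [setLIntegral_const]
    _ ≤ ∫⁻ y in S, ENNReal.ofReal (1 / ‖x - y‖ ^ N) := by
      refine setLIntegral_mono_ae' hSm ?_
      have : ∀ᵐ y : Rn n, y ≠ x := by simp [ae_iff]
      filter_upwards [this] with y hy hyS
      have h1 : 0 < ‖x - y‖ := norm_pos_iff.2 (sub_ne_zero.2 hy.symm)
      have h2 : ‖x - y‖ ≤ r := by
        have := hyS.1.2
        rw [mem_ball', dist_eq_norm] at this
        exact this.le
      gcongr
    _ ≤ _ := lintegral_mono_set (sdiff_subset_sdiff_left inter_subset_left)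

section

variable {n : ℕ} {s p Λ : ℝ} {Φ : ℝ → ℝ} {K : Rn n → Rn n → ℝ}

/-- The Gagliardo energy on the whole space as an integral over the product space. -/
def energy (n : ℕ) (s p : ℝ) (v : Rn n → ℝ) : ℝ≥0∞ :=
  ∫⁻ z : Rn n × Rn n, ENNReal.ofReal (|v z.1 - v z.2| ^ p / ‖z.1 - z.2‖ ^ ((n : ℝ) + s * p))
    ∂(volume.prod volume)

theorem gagliardo_univ {v : Rn n → ℝ} (hv : Measurable v) :
    gagliardo n s p univ v = energy n s p v := by
  rw [energy, gagliardo, lintegral_prod _ (Measurable.aemeasurable (by fun_prop))]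
  simp only [Measure.restrict_univ]

theorem abs_phi_le (hΛ : 1 ≤ Λ) (hΦ : PhiBounds Λ p Φ) (t : ℝ) :
    |Φ t| ≤ Λ * |t| ^ (p - 1) := by
  rcases eq_or_ne t 0 with rfl | ht
  · rw [hΦ.2.1, abs_zero]; positivity
  have h0 : 0 < |t| := abs_pos.2 ht
  have h1 := hΦ.2.2 t
  have h2 : |Φ t| * |t| ≤ Λ * |t| ^ p := by
    rw [← abs_mul, abs_of_nonneg (le_trans (by positivity) h1.1)]; exact h1.2
  rw [Real.rpow_sub_one h0.ne', mul_div_assoc', le_div_iff₀ h0]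
  exact h2

theorem le_abs_phi (hΛ : 1 ≤ Λ) (hp : 1 < p) (hΦ : PhiBounds Λ p Φ) (t : ℝ) :
    |t| ^ (p - 1) / Λ ≤ |Φ t| := by
  rcases eq_or_ne t 0 with rfl | ht
  · rw [abs_zero, Real.zero_rpow (by linarith), zero_div]; positivity
  have h0 : 0 < |t| := abs_pos.2 ht
  have h1 := hΦ.2.2 t
  have h2 : |t| ^ p / Λ ≤ |Φ t| * |t| := by
    rw [← abs_mul, abs_of_nonneg (le_trans (by positivity) h1.1)]; exact h1.1
  rw [Real.rpow_sub_one h0.ne', div_right_comm, div_le_iff₀ h0]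
  exact h2

theorem kernel_nonneg (hΛ : 1 ≤ Λ) (hK : KernelBounds n Λ s p K) {x y : Rn n} (h : x ≠ y) :
    0 ≤ K x y :=
  le_trans (by positivity) (hK.2 x y h).1

theorem abs_form_le (hΛ : 1 ≤ Λ) (hK : KernelBounds n Λ s p K)
    (hΦ : PhiBounds Λ p Φ) (t : ℝ) (φ : Rn n → ℝ) (x y : Rn n) :
    |Φ t * (φ x - φ y) * K x y| ≤
      Λ ^ 2 * (|t| ^ (p - 1) * |φ x - φ y| / ‖x - y‖ ^ ((n : ℝ) + s * p)) := by
  rcases eq_or_ne x y with rfl | h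
  · simp
  rw [abs_mul, abs_mul, abs_of_nonneg (kernel_nonneg hΛ hK h)]
  calc |Φ t| * |φ x - φ y| * K x y
      ≤ (Λ * |t| ^ (p - 1)) * |φ x - φ y| * (Λ / ‖x - y‖ ^ ((n : ℝ) + s * p)) := by
        gcongr
        · exact kernel_nonneg hΛ hK h
        · exact abs_phi_le hΛ hΦ t
        · exact (hK.2 x y h).2
    _ = _ := by ring

theorem le_form_of_monotone (hΛ : 1 ≤ Λ) (hp : 1 < p) (hK : KernelBounds n Λ s p K)
    (hΦ : PhiBounds Λ p Φ) {ψ : ℝ → ℝ} (hψ : Monotone ψ) (v : Rn n → ℝ) (x y : Rn n) :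
    (Λ ^ 2)⁻¹ * (|v x - v y| ^ (p - 1) * |ψ (v x) - ψ (v y)| / ‖x - y‖ ^ ((n : ℝ) + s * p)) ≤
      Φ (v x - v y) * (ψ (v x) - ψ (v y)) * K x y := by
  rcases eq_or_ne x y with rfl | h
  · simp
  have hsign : 0 ≤ Φ (v x - v y) * (ψ (v x) - ψ (v y)) := by
    have h0 : 0 ≤ Φ (v x - v y) * (v x - v y) :=
      le_trans (by positivity) (hΦ.2.2 _).1
    rcases lt_trichotomy (v x) (v y) with hxy | hxy | hxy
    · exact mul_nonneg_of_nonpos_of_nonpos (nonpos_of_mul_nonneg_left h0 (by linarith))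
        (by linarith [hψ hxy.le])
    · simp [hxy]
    · exact mul_nonneg (nonneg_of_mul_nonneg_left h0 (by linarith)) (by linarith [hψ hxy.le])
  rw [← abs_of_nonneg hsign, abs_mul]
  calc _ = (|v x - v y| ^ (p - 1) / Λ) * |ψ (v x) - ψ (v y)| *
        (1 / (Λ * ‖x - y‖ ^ ((n : ℝ) + s * p))) := by
        field_simp
    _ ≤ _ := by
        gcongr
        · exact le_abs_phi hΛ hp hΦ _
        · exact (hK.2 x y h).1

theorem measurable_form (hK : KernelBounds n Λ s p K) (hΦ : PhiBounds Λ p Φ) {v φ : Rn n → ℝ}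
    (hv : Measurable v) (hφ : Measurable φ) :
    Measurable fun z : Rn n × Rn n => Φ (v z.1 - v z.2) * (φ z.1 - φ z.2) * K z.1 z.2 := by
  have h1 : Measurable Φ := hΦ.1.measurable
  have h2 : Measurable fun z : Rn n × Rn n => K z.1 z.2 := hK.1
  fun_prop

theorem lintegral_mixed_le (hp : 1 < p) {v φ : Rn n → ℝ} (hv : Measurable v) {ε : ℝ} (hε : 0 < ε) :
    ∫⁻ z : Rn n × Rn n, ENNReal.ofReal (|v z.1 - v z.2| ^ (p - 1) * |φ z.1 - φ z.2| /
        ‖z.1 - z.2‖ ^ ((n : ℝ) + s * p)) ∂(volume.prod volume) ≤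
      ENNReal.ofReal ε * energy n s p v + ENNReal.ofReal (ε ^ (-(p - 1))) * energy n s p φ := by
  rw [energy, energy, ← lintegral_const_mul' _ _ ENNReal.ofReal_ne_top,
    ← lintegral_const_mul' _ _ ENNReal.ofReal_ne_top,
    ← lintegral_add_left (by fun_prop)]
  refine lintegral_mono fun z => ?_
  rw [← ENNReal.ofReal_mul (by positivity), ← ENNReal.ofReal_mul (by positivity),
    ← ENNReal.ofReal_add (by positivity) (by positivity)]
  refine ENNReal.ofReal_le_ofReal ?_
  rw [mul_div_assoc', mul_div_assoc', ← add_div]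
  refine div_le_div_of_nonneg_right ?_ (by positivity)
  exact rpow_mul_le_add (abs_nonneg _) (abs_nonneg _) hε hp

theorem integrable_form (hΛ : 1 ≤ Λ) (hp : 1 < p) (hK : KernelBounds n Λ s p K)
    (hΦ : PhiBounds Λ p Φ) {v φ : Rn n → ℝ} (hv : Measurable v) (hφ : Measurable φ)
    (hve : energy n s p v < ⊤) (hφe : energy n s p φ < ⊤) :
    Integrable (fun z : Rn n × Rn n => Φ (v z.1 - v z.2) * (φ z.1 - φ z.2) * K z.1 z.2)
      (volume.prod volume) := by
  refine ⟨(measurable_form hK hΦ hv hφ).aestronglyMeasurable, ?_⟩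
  rw [hasFiniteIntegral_iff_norm]
  have h := lintegral_mixed_le (s := s) hp (v := v) (φ := φ) hv zero_lt_one
  have h' : ENNReal.ofReal (Λ ^ 2) * (ENNReal.ofReal 1 * energy n s p v +
      ENNReal.ofReal (1 ^ (-(p - 1))) * energy n s p φ) < ⊤ :=
    ENNReal.mul_lt_top ENNReal.ofReal_lt_top (ENNReal.add_lt_top.2
      ⟨ENNReal.mul_lt_top ENNReal.ofReal_lt_top hve, ENNReal.mul_lt_top ENNReal.ofReal_lt_top hφe⟩)
  refine lt_of_le_of_lt ?_ (lt_of_le_of_lt (mul_le_mul_right h (ENNReal.ofReal (Λ ^ 2))) h')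
  rw [← lintegral_const_mul' _ _ ENNReal.ofReal_ne_top]
  refine lintegral_mono fun z => ?_
  rw [← ENNReal.ofReal_mul (by positivity)]
  exact ENNReal.ofReal_le_ofReal (abs_form_le hΛ hK hΦ _ φ _ _)

theorem tendsto_lintegral_translate {E : Type*} [NormedAddCommGroup E] [MeasurableSpace E]
    [BorelSpace E] [LocallyCompactSpace E] [SecondCountableTopology E] {ν : Measure E}
    [ν.IsAddHaarMeasure] (hp : 1 < p) {G : E → ℝ} (hG : MemLp G (ENNReal.ofReal p) ν) :
    Tendsto (fun w : E => ∫⁻ z, ENNReal.ofReal (|G (w + z) - G z| ^ p) ∂ν) (𝓝 0) (𝓝 0) := by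
  have : Fact (1 ≤ ENNReal.ofReal p) := ⟨by simpa using hp.le⟩
  have : Fact (ENNReal.ofReal p ≠ ⊤) := ⟨ENNReal.ofReal_ne_top⟩
  have hc : Continuous fun w : E => DomAddAct.mk w +ᵥ hG.toLp G :=
    (DomAddAct.continuous_mk).vadd continuous_const
  have ht := hc.tendsto 0
  rw [tendsto_iff_edist_tendsto_0] at ht
  have ht2 := ((ENNReal.continuous_rpow_const (y := p)).tendsto 0).comp ht
  rw [ENNReal.zero_rpow_of_pos (by linarith)] at ht2
  refine ht2.congr fun w => ?_
  have e1 : DomAddAct.mk (0 : E) +ᵥ hG.toLp G = hG.toLp G := by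
    rw [DomAddAct.mk_zero, zero_vadd]
  have e2 : eLpNorm (fun z => G (w + z) - G z) (ENNReal.ofReal p) ν =
      edist (DomAddAct.mk w +ᵥ hG.toLp G) (hG.toLp G) := by
    rw [Lp.edist_def]
    refine eLpNorm_congr_ae ?_
    have h1 := DomAddAct.vadd_Lp_ae_eq (DomAddAct.mk w) (hG.toLp G)
    have h2 := hG.coeFn_toLp
    have h3 := (measurePreserving_add_left ν w).quasiMeasurePreserving.ae_eq_comp h2
    filter_upwards [h1, h2, h3] with z z1 z2 z3
    rw [Pi.sub_apply, z1, z2, Equiv.symm_apply_apply]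
    exact congrArg (· - G z) z3.symm
  simp only [Function.comp, e1]
  rw [← e2, eLpNorm_eq_lintegral_rpow_enorm_toReal (by simp; linarith) ENNReal.ofReal_ne_top,
    ENNReal.toReal_ofReal (by linarith), ← ENNReal.rpow_mul, one_div_mul_cancel (by linarith),
    ENNReal.rpow_one]
  refine lintegral_congr fun z => ?_
  rw [← ofReal_norm, ENNReal.ofReal_rpow_of_nonneg (norm_nonneg _) (by linarith),
    Real.norm_eq_abs]

theorem integral_norm_form_le (hΛ : 1 ≤ Λ) (hp : 1 < p) (hK : KernelBounds n Λ s p K)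
    {v φ : Rn n → ℝ} (hΦ : PhiBounds Λ p Φ) (hv : Measurable v) (hφ : Measurable φ)
    (hve : energy n s p v < ⊤) (hφe : energy n s p φ < ⊤) {ε : ℝ} (hε : 0 < ε) :
    ∫ z : Rn n × Rn n, ‖Φ (v z.1 - v z.2) * (φ z.1 - φ z.2) * K z.1 z.2‖ ∂(volume.prod volume) ≤
      Λ ^ 2 * (ε * (energy n s p v).toReal + ε ^ (-(p - 1)) * (energy n s p φ).toReal) := by
  rw [integral_eq_lintegral_of_nonneg_ae (.of_forall fun _ => norm_nonneg _)
    (measurable_form hK hΦ hv hφ).norm.aestronglyMeasurable]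
  refine ENNReal.toReal_le_of_le_ofReal (by positivity) ?_
  rw [ENNReal.ofReal_mul (by positivity), ENNReal.ofReal_add (by positivity) (by positivity),
    ENNReal.ofReal_mul hε.le, ENNReal.ofReal_mul (by positivity), ENNReal.ofReal_toReal hve.ne,
    ENNReal.ofReal_toReal hφe.ne]
  refine le_trans ?_ (mul_le_mul_right (lintegral_mixed_le hp hv hε) _)
  rw [← lintegral_const_mul' _ _ ENNReal.ofReal_ne_top]
  refine lintegral_mono fun z => ?_
  rw [← ENNReal.ofReal_mul (by positivity)]
  exact ENNReal.ofReal_le_ofReal (abs_form_le hΛ hK hΦ _ φ _ _)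

theorem energy_translate (φ : Rn n → ℝ) (w : Rn n) :
    energy n s p (fun x => φ (x - w)) = energy n s p φ := by
  have h := lintegral_sub_right_eq_self (μ := (volume : Measure (Rn n)).prod volume)
    (fun z : Rn n × Rn n =>
      ENNReal.ofReal (|φ z.1 - φ z.2| ^ p / ‖z.1 - z.2‖ ^ ((n : ℝ) + s * p))) (w, w)
  rw [energy, energy, ← h]
  simp

theorem tendsto_energy_translate_sub (hp : 1 < p) {φ : Rn n → ℝ} (hφ : Measurable φ)
    (hφe : energy n s p φ < ⊤) :
    Tendsto (fun w : Rn n => energy n s p (fun x => φ (x - w) - φ x)) (𝓝 0) (𝓝 0) := by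
  set N : ℝ := (n : ℝ) + s * p with hN
  set G : Rn n × Rn n → ℝ := fun z => (φ z.1 - φ z.2) / ‖z.1 - z.2‖ ^ (N / p) with hGdef
  have hp0 : p ≠ 0 := by linarith
  have habs : ∀ a b : ℝ, 0 ≤ b → |a / b ^ (N / p)| ^ p = |a| ^ p / b ^ N := fun a b hb => by
    rw [abs_div, Real.div_rpow (abs_nonneg _) (abs_nonneg _), abs_of_nonneg (Real.rpow_nonneg hb _),
      ← Real.rpow_mul hb, div_mul_cancel₀ _ hp0]
  have hGm : Measurable G := by fun_prop
  have hG : MemLp G (ENNReal.ofReal p) ((volume : Measure (Rn n)).prod volume) := by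
    refine ⟨hGm.aestronglyMeasurable, ?_⟩
    rw [eLpNorm_lt_top_iff_lintegral_rpow_enorm_lt_top (by simp; linarith) ENNReal.ofReal_ne_top,
      ENNReal.toReal_ofReal (by linarith)]
    refine lt_of_eq_of_lt (lintegral_congr fun z => ?_) hφe
    rw [← ofReal_norm, ENNReal.ofReal_rpow_of_nonneg (norm_nonneg _) (by linarith),
      Real.norm_eq_abs, habs _ _ (norm_nonneg _)]
  have ht := tendsto_lintegral_translate hp hG
  have hc : Tendsto (fun w : Rn n => ((-w, -w) : Rn n × Rn n)) (𝓝 0) (𝓝 0) := by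
    have : Continuous fun w : Rn n => ((-w, -w) : Rn n × Rn n) := by fun_prop
    have h0 := this.tendsto 0
    rwa [neg_zero] at h0
  refine (ht.comp hc).congr fun w => lintegral_congr fun z => ?_
  have e : G ((-w, -w) + z) - G z =
      ((φ (z.1 - w) - φ z.1) - (φ (z.2 - w) - φ z.2)) / ‖z.1 - z.2‖ ^ (N / p) := by
    simp only [hGdef, Prod.fst_add, Prod.snd_add, neg_add_eq_sub, sub_sub_sub_cancel_right]
    ring
  rw [e, habs _ _ (norm_nonneg _)]

theorem tendsto_form_translate (hΛ : 1 ≤ Λ) (hp : 1 < p) (hK : KernelBounds n Λ s p K)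
    {v φ : Rn n → ℝ} (hΦ : PhiBounds Λ p Φ) (hv : Measurable v) (hφ : Measurable φ)
    (hve : energy n s p v < ⊤) (hφe : energy n s p φ < ⊤) :
    Tendsto (fun w : Rn n => ∫ z : Rn n × Rn n,
        Φ (v z.1 - v z.2) * (φ (z.1 - w) - φ (z.2 - w)) * K z.1 z.2 ∂(volume.prod volume)) (𝓝 0)
      (𝓝 (∫ z : Rn n × Rn n,
        Φ (v z.1 - v z.2) * (φ z.1 - φ z.2) * K z.1 z.2 ∂(volume.prod volume))) := by
  have he := tendsto_energy_translate_sub (s := s) hp hφ hφe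
  set A := (energy n s p v).toReal
  have hA : 0 ≤ A := ENNReal.toReal_nonneg
  rw [Metric.tendsto_nhds]
  intro δ hδ
  obtain ⟨ε, hε, hεA⟩ : ∃ ε : ℝ, 0 < ε ∧ Λ ^ 2 * (ε * A) ≤ δ / 2 := by
    refine ⟨δ / (2 * (Λ ^ 2 * (A + 1))), by positivity, ?_⟩
    rw [show Λ ^ 2 * (δ / (2 * (Λ ^ 2 * (A + 1))) * A) = (δ / 2) * (A / (A + 1)) by field_simp]
    exact mul_le_of_le_one_right (by positivity) ((div_le_one (by positivity)).2 (by linarith))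
  have hc : 0 < Λ ^ 2 * ε ^ (-(p - 1)) := by positivity
  have hr := (ENNReal.tendsto_toReal ENNReal.zero_ne_top).comp he
  rw [ENNReal.toReal_zero] at hr
  have h1 := hr.eventually_lt_const (u := δ / 2 / (Λ ^ 2 * ε ^ (-(p - 1)))) (by positivity)
  filter_upwards [h1, he.eventually_lt_const ENNReal.zero_lt_top] with w hw hwtop
  have hφw : Measurable fun x => φ (x - w) := by fun_prop
  have i1 := integrable_form hΛ hp hK hΦ hv hφw hve (by rwa [energy_translate])
  have i2 := integrable_form hΛ hp hK hΦ hv hφ hve hφe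
  have hb := integral_norm_form_le hΛ hp hK hΦ hv (hφw.sub hφ) hve hwtop hε
  rw [Real.dist_eq, ← integral_sub i1 i2, ← Real.norm_eq_abs]
  refine (norm_integral_le_integral_norm _).trans_lt ?_
  have e : ∀ z : Rn n × Rn n, Φ (v z.1 - v z.2) * (φ (z.1 - w) - φ (z.2 - w)) * K z.1 z.2 -
      Φ (v z.1 - v z.2) * (φ z.1 - φ z.2) * K z.1 z.2 = Φ (v z.1 - v z.2) *
        (((fun x => φ (x - w)) - φ) z.1 - ((fun x => φ (x - w)) - φ) z.2) * K z.1 z.2 := fun z => by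
    simp only [Pi.sub_apply]; ring
  simp only [e]
  refine hb.trans_lt ?_
  rw [lt_div_iff₀ hc] at hw
  simp only [Function.comp] at hw
  change Λ ^ 2 * (ε * A + ε ^ (-(p - 1)) * (energy n s p (fun x => φ (x - w) - φ x)).toReal) < δ
  nlinarith

theorem integrable_form_translate (hΛ : 1 ≤ Λ) (hp : 1 < p) (hK : KernelBounds n Λ s p K)
    {v φ ρ : Rn n → ℝ} (hΦ : PhiBounds Λ p Φ) (hv : Measurable v) (hφ : Measurable φ)
    (hve : energy n s p v < ⊤) (hφe : energy n s p φ < ⊤) (hρ : Measurable ρ)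
    (hρi : Integrable ρ) :
    Integrable (fun q : Rn n × (Rn n × Rn n) => ρ q.1 * (Φ (v q.2.1 - v q.2.2) *
      (φ (q.2.1 - q.1) - φ (q.2.2 - q.1)) * K q.2.1 q.2.2))
      (volume.prod (volume.prod volume)) := by
  have hm : Measurable fun q : Rn n × (Rn n × Rn n) => ρ q.1 * (Φ (v q.2.1 - v q.2.2) *
      (φ (q.2.1 - q.1) - φ (q.2.2 - q.1)) * K q.2.1 q.2.2) := by
    have h1 : Measurable Φ := hΦ.1.measurable
    have h2 : Measurable fun z : Rn n × (Rn n × Rn n) => K z.2.1 z.2.2 := hK.1.comp measurable_snd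
    have h3 : Measurable fun q : Rn n × (Rn n × Rn n) =>
        Φ (v q.2.1 - v q.2.2) * (φ (q.2.1 - q.1) - φ (q.2.2 - q.1)) := by fun_prop
    exact (hρ.comp measurable_fst).mul (h3.mul h2)
  refine (integrable_prod_iff hm.aestronglyMeasurable).2 ⟨.of_forall fun w => ?_, ?_⟩
  · exact (integrable_form hΛ hp hK hΦ hv (by fun_prop : Measurable fun x => φ (x - w)) hve
      (by rwa [energy_translate])).const_mul (ρ w)
  · refine (hρi.norm.mul_const (Λ ^ 2 * (1 * (energy n s p v).toReal +
      1 ^ (-(p - 1)) * (energy n s p φ).toReal))).mono'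
      hm.norm.aestronglyMeasurable.integral_prod_right' (.of_forall fun w => ?_)
    simp only [norm_mul (ρ w)]
    rw [integral_const_mul, norm_mul, norm_norm]
    have := integral_norm_form_le hΛ hp hK hΦ hv (by fun_prop : Measurable fun x => φ (x - w)) hve
      (by rwa [energy_translate]) zero_lt_one
    rw [energy_translate] at this
    rw [Real.norm_of_nonneg (integral_nonneg fun _ => norm_nonneg _)]
    gcongr

theorem integrable_of_bounded_of_support {φ : Rn n → ℝ} {z : Rn n} {m r : ℝ} (hφ : Measurable φ)
    (hm : ∀ x, |φ x| ≤ m) (hs : ∀ x, x ∉ closedBall z r → φ x = 0) : Integrable φ := by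
  have h : IntegrableOn φ (closedBall z r) :=
    Measure.integrableOn_of_bounded (M := m) (isCompact_closedBall z r).measure_lt_top.ne
      hφ.aestronglyMeasurable (.of_forall hm)
  exact (integrableOn_iff_integrable_of_support_subset fun x hx => by
    by_contra hx'; exact hx (hs x hx')).1 h

theorem continuous_integral_translate_mul {φ f : Rn n → ℝ} (hφ : Integrable φ) (hf : Continuous f)
    {M : ℝ} (hM : ∀ x, |f x| ≤ M) : Continuous fun w : Rn n => ∫ x, φ (x - w) * f x := by
  have e : ∀ w : Rn n, ∫ x, φ (x - w) * f x = ∫ x, φ x * f (x + w) := fun w => by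
    rw [← integral_add_right_eq_self _ w]; simp
  simp only [e]
  refine continuous_of_dominated (bound := fun x => ‖φ x‖ * M)
    (fun w => hφ.aestronglyMeasurable.mul (Continuous.aestronglyMeasurable (by fun_prop)))
    (fun w => .of_forall fun x => ?_) (hφ.norm.mul_const M) (.of_forall fun x => by fun_prop)
  rw [norm_mul]
  gcongr
  exact hM _

theorem weak_form_extended (hΛ : 1 ≤ Λ) (hp : 1 < p) (hK : KernelBounds n Λ s p K)
    (hΦ : PhiBounds Λ p Φ) {Ω : Set (Rn n)} {z₀ : Rn n} {r r' m : ℝ} (hr : r < r')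
    (hΩ : closedBall z₀ r' ⊆ Ω) {v f φ : Rn n → ℝ} (hv : Measurable v)
    (hve : energy n s p v < ⊤) (hf : Continuous f) (hfc : HasCompactSupport f)
    (hweak : ∀ φ : Rn n → ℝ, IsTestFun n Ω φ → nonlocalForm n Φ K v φ = ∫ x, φ x * f x)
    (hφ : Measurable φ) (hφm : ∀ x, |φ x| ≤ m) (hφs : ∀ x, x ∉ closedBall z₀ r → φ x = 0)
    (hφe : energy n s p φ < ⊤) :
    ∫ z : Rn n × Rn n, Φ (v z.1 - v z.2) * (φ z.1 - φ z.2) * K z.1 z.2 ∂(volume.prod volume) =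
      ∫ x, φ x * f x := by
  obtain ⟨M, hM⟩ := hfc.exists_bound_of_continuous hf
  have hφi := integrable_of_bounded_of_support hφ hφm hφs
  set H : Rn n → ℝ := fun w => ∫ z : Rn n × Rn n,
    Φ (v z.1 - v z.2) * (φ (z.1 - w) - φ (z.2 - w)) * K z.1 z.2 ∂(volume.prod volume) with hH
  set J : Rn n → ℝ := fun w => ∫ x, φ (x - w) * f x with hJ
  have hJc : Continuous J := continuous_integral_translate_mul hφi hf hM
  have hHt := tendsto_form_translate hΛ hp hK hΦ hv hφ hve hφe
  have hHm : StronglyMeasurable H := by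
    have hmeas : Measurable fun q : Rn n × (Rn n × Rn n) => Φ (v q.2.1 - v q.2.2) *
        (φ (q.2.1 - q.1) - φ (q.2.2 - q.1)) * K q.2.1 q.2.2 := by
      have h1 : Measurable Φ := hΦ.1.measurable
      have h2 : Measurable fun z : Rn n × (Rn n × Rn n) => K z.2.1 z.2.2 :=
        hK.1.comp measurable_snd
      have h3 : Measurable fun q : Rn n × (Rn n × Rn n) =>
        Φ (v q.2.1 - v q.2.2) * (φ (q.2.1 - q.1) - φ (q.2.2 - q.1)) := by fun_prop
      exact h3.mul h2
    exact hmeas.stronglyMeasurable.integral_prod_right'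
  have hH0 : H 0 = ∫ z : Rn n × Rn n,
      Φ (v z.1 - v z.2) * (φ z.1 - φ z.2) * K z.1 z.2 ∂(volume.prod volume) := by simp [hH]
  have hJ0 : J 0 = ∫ x, φ x * f x := by simp [hJ]
  rw [← hH0, ← hJ0]
  rw [← hH0] at hHt
  have hWt : Tendsto (fun w => H w - J w) (𝓝 0) (𝓝 (H 0 - J 0)) := hHt.sub (hJc.tendsto 0)
  have hsmall : ∀ b : ContDiffBump (0 : Rn n), b.rOut ≤ r' - r →
      ∫ w, b.normed volume w * (H w - J w) = 0 := by
    intro b hb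
    set ρ : Rn n → ℝ := b.normed volume
    have hρc : Continuous ρ := b.continuous_normed
    have hρi : Integrable ρ := b.integrable_normed
    set φρ : Rn n → ℝ := fun x => ∫ w, ρ w * φ (x - w) with hφρ
    have hconv : φρ = convolution ρ φ (ContinuousLinearMap.lsmul ℝ ℝ) volume := by
      ext x; simp [hφρ, convolution]
    have hsupp : tsupport φρ ⊆ closedBall z₀ r' := by
      refine closure_minimal ?_ isClosed_closedBall
      rw [hconv]
      refine (support_convolution_subset _).trans ?_
      rintro _ ⟨x, hx, y, hy, rfl⟩
      rw [b.support_normed_eq, mem_ball_zero_iff] at hx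
      have hy' : y ∈ closedBall z₀ r := by by_contra h; exact hy (hφs y h)
      rw [mem_closedBall, dist_eq_norm] at hy' ⊢
      calc ‖x + y - z₀‖ ≤ ‖x‖ + ‖y - z₀‖ := by rw [add_sub_assoc]; exact norm_add_le _ _
        _ ≤ r' := by linarith
    have htest : IsTestFun n Ω φρ := by
      refine ⟨?_, (isCompact_closedBall z₀ r').of_isClosed_subset (isClosed_tsupport _) hsupp,
        hsupp.trans hΩ⟩
      rw [hconv]
      exact b.hasCompactSupport_normed.contDiff_convolution_left _ b.contDiff_normed
        hφi.locallyIntegrable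
    have hT := integrable_form_translate hΛ hp hK hΦ hv hφ hve hφe hρc.measurable hρi
    have hρφ : ∀ x, Integrable fun w => ρ w * φ (x - w) := fun x =>
      hρi.mul_bdd (c := m)
        (Measurable.aestronglyMeasurable (by fun_prop : Measurable fun w => φ (x - w)))
        (.of_forall fun w => hφm _)
    have e1 : ∀ z : Rn n × Rn n, ∫ w, ρ w * (Φ (v z.1 - v z.2) *
        (φ (z.1 - w) - φ (z.2 - w)) * K z.1 z.2) =
        Φ (v z.1 - v z.2) * (φρ z.1 - φρ z.2) * K z.1 z.2 := fun z => by
      simp only [hφρ]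
      rw [← integral_sub (hρφ _) (hρφ _), ← integral_const_mul, ← integral_mul_const]
      exact integral_congr_ae (.of_forall fun w => by ring)
    have e2 : ∫ w, ρ w * H w = nonlocalForm n Φ K v φρ := by
      have i1 := hT.integral_prod_right
      simp only [e1] at i1
      rw [nonlocalForm, ← integral_prod
        (fun z : Rn n × Rn n => Φ (v z.1 - v z.2) * (φρ z.1 - φρ z.2) * K z.1 z.2) i1]
      simp only [← e1, hH, ← integral_const_mul]
      exact integral_integral_swap hT
    have hfi : Integrable f := hf.integrable_of_hasCompactSupport hfc
    have hT2 : Integrable (fun q : Rn n × Rn n => ρ q.1 * (φ (q.2 - q.1) * f q.2))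
        (volume.prod volume) := by
      refine ((hρi.mul_prod hfi).mul_bdd (c := m)
        (g := fun q : Rn n × Rn n => φ (q.2 - q.1))
        (Measurable.aestronglyMeasurable (by fun_prop)) (.of_forall fun q => hφm _)).congr
        (.of_forall fun q => by simp only; ring)
    have e3 : ∫ w, ρ w * J w = ∫ x, φρ x * f x := by
      simp only [hJ, ← integral_const_mul]
      refine (integral_integral_swap hT2).trans (integral_congr_ae (.of_forall fun x => ?_))
      simp only [hφρ, ← integral_mul_const]
      exact integral_congr_ae (.of_forall fun w => by ring)
    have i2 : Integrable fun w => ρ w * H w := by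
      have := hT.integral_prod_left
      simpa only [integral_const_mul] using this
    have i3 : Integrable fun w => ρ w * J w := by
      have := hT2.integral_prod_left
      simpa only [integral_const_mul] using this
    simp only [mul_sub]
    rw [integral_sub i2 i3, e2, e3, hweak _ htest, sub_self]
  by_contra hne
  have hd : 0 < |H 0 - J 0| / 2 := by have := abs_pos.2 (sub_ne_zero.2 hne); positivity
  obtain ⟨ε, hε, hball⟩ := Metric.eventually_nhds_iff_ball.1 (Metric.tendsto_nhds.1 hWt _ hd)
  set b : ContDiffBump (0 : Rn n) :=
    ⟨min ε (r' - r) / 2, min ε (r' - r), by have := lt_min hε (sub_pos.2 hr); linarith,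
      by have := lt_min hε (sub_pos.2 hr); linarith⟩
  have h1 := b.dist_normed_convolution_le (μ := volume) (g := fun w => H (-w) - J (-w)) (x₀ := 0)
    (ε := |H 0 - J 0| / 2)
    (((hHm.comp_measurable measurable_neg).sub
      (hJc.stronglyMeasurable.comp_measurable measurable_neg)).aestronglyMeasurable)
    (fun w hw => by
      have : -w ∈ ball (0 : Rn n) ε := by
        rw [mem_ball_zero_iff] at hw ⊢
        rw [norm_neg]; exact hw.trans_le (min_le_left _ _)
      simpa using (hball _ this).le)
  have h2 : convolution (b.normed volume) (fun w => H (-w) - J (-w))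
      (ContinuousLinearMap.lsmul ℝ ℝ) volume 0 = 0 := by
    have := hsmall b (min_le_right _ _)
    simpa [convolution] using this
  rw [h2, neg_zero, Real.dist_eq, zero_sub, abs_neg] at h1
  linarith

/-- The localized coercive part of the form tested with a function of `v`. -/
def weightedForm (n : ℕ) (s p : ℝ) (η : Rn n → ℝ) (ψ : ℝ → ℝ) (v : Rn n → ℝ) : ℝ≥0∞ :=
  ∫⁻ z : Rn n × Rn n, ENNReal.ofReal ((η z.1 + η z.2) * (|v z.1 - v z.2| ^ (p - 1) *
    |ψ (v z.1) - ψ (v z.2)| / ‖z.1 - z.2‖ ^ ((n : ℝ) + s * p))) ∂(volume.prod volume)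

/-- The error produced by differentiating the cutoff. -/
def cutoffError (n : ℕ) (s p : ℝ) (η v : Rn n → ℝ) : ℝ≥0∞ :=
  ∫⁻ z : Rn n × Rn n, ENNReal.ofReal (|v z.1 - v z.2| ^ (p - 1) * |η z.1 - η z.2| /
    ‖z.1 - z.2‖ ^ ((n : ℝ) + s * p)) ∂(volume.prod volume)

theorem energy_comp_le (hp : 1 < p) {ψ : ℝ → ℝ} (hψ : ∀ a b, |ψ a - ψ b| ≤ |a - b|) (v : Rn n → ℝ) :
    energy n s p (fun x => ψ (v x)) ≤ energy n s p v := by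
  refine lintegral_mono fun z => ENNReal.ofReal_le_ofReal ?_
  refine div_le_div_of_nonneg_right ?_ (by positivity)
  exact Real.rpow_le_rpow (abs_nonneg _) (hψ _ _) (by linarith)

theorem energy_cutoff_mul_lt_top (hn : 2 ≤ n) (hs : 0 < s) (hs1 : s < 1) (hp : 1 < p)
    {η : Rn n → ℝ} {L : ℝ≥0} (hη : LipschitzWith L η) (h0 : ∀ x, 0 ≤ η x) (h1 : ∀ x, η x ≤ 1)
    {ψ : ℝ → ℝ} (hψ0 : ψ 0 = 0) (hψ : ∀ a b, |ψ a - ψ b| ≤ |a - b|) {v : Rn n → ℝ}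
    (hv : Measurable v) (hve : energy n s p v < ⊤) (hvp : ∫⁻ x, ENNReal.ofReal (|v x| ^ p) < ⊤) :
    energy n s p (fun x => η x * ψ (v x)) < ⊤ := by
  obtain ⟨C, hC, hCb⟩ := lintegral_cutoff_le n hn hs hs1 hp hη h0 h1
  have hηm : Measurable η := hη.continuous.measurable
  have hle : energy n s p (fun x => η x * ψ (v x)) ≤ ENNReal.ofReal (2 ^ p) *
      (energy n s p v + ∫⁻ z : Rn n × Rn n, ENNReal.ofReal (|v z.1| ^ p) *
        ENNReal.ofReal (|η z.1 - η z.2| ^ p / ‖z.1 - z.2‖ ^ ((n : ℝ) + s * p))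
        ∂(volume.prod volume)) := by
    rw [energy, energy, ← lintegral_add_left (by fun_prop),
      ← lintegral_const_mul' _ _ ENNReal.ofReal_ne_top]
    refine lintegral_mono fun z => ?_
    rw [← ENNReal.ofReal_mul (by positivity), ← ENNReal.ofReal_add (by positivity) (by positivity),
      ← ENNReal.ofReal_mul (by positivity)]
    refine ENNReal.ofReal_le_ofReal ?_
    rw [mul_div_assoc', ← add_div, mul_div_assoc']
    refine div_le_div_of_nonneg_right ?_ (by positivity)
    have e : η z.1 * ψ (v z.1) - η z.2 * ψ (v z.2) =
        η z.2 * (ψ (v z.1) - ψ (v z.2)) + ψ (v z.1) * (η z.1 - η z.2) := by ring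
    rw [e]
    refine (abs_add_rpow_le _ _ (by linarith)).trans ?_
    rw [← Real.mul_rpow (abs_nonneg _) (abs_nonneg _)]
    have hψv : |ψ (v z.1)| ≤ |v z.1| := by simpa [hψ0] using hψ (v z.1) 0
    have b1 : |η z.2 * (ψ (v z.1) - ψ (v z.2))| ≤ |v z.1 - v z.2| := by
      rw [abs_mul, abs_of_nonneg (h0 _)]
      exact (mul_le_of_le_one_left (abs_nonneg _) (h1 _)).trans (hψ _ _)
    have b2 : |ψ (v z.1) * (η z.1 - η z.2)| ≤ |v z.1| * |η z.1 - η z.2| := by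
      rw [abs_mul]; gcongr
    exact mul_le_mul_of_nonneg_left (add_le_add
      (Real.rpow_le_rpow (abs_nonneg _) b1 (by linarith))
      (Real.rpow_le_rpow (abs_nonneg _) b2 (by linarith))) (by positivity)
  refine hle.trans_lt (ENNReal.mul_lt_top ENNReal.ofReal_lt_top (ENNReal.add_lt_top.2 ⟨hve, ?_⟩))
  rw [lintegral_prod _ (Measurable.aemeasurable (by fun_prop))]
  calc _ ≤ ∫⁻ x, ENNReal.ofReal (|v x| ^ p) * C := lintegral_mono fun x => by
        dsimp only
        rw [lintegral_const_mul' _ _ ENNReal.ofReal_ne_top]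
        exact mul_le_mul_right (hCb x) _
    _ = (∫⁻ x, ENNReal.ofReal (|v x| ^ p)) * C := lintegral_mul_const' _ _ hC.ne
    _ < ⊤ := ENNReal.mul_lt_top hvp hC

theorem ofReal_abs_integral_le {α : Type*} [MeasurableSpace α] {ν : Measure α} (h : α → ℝ) :
    ENNReal.ofReal |∫ x, h x ∂ν| ≤ ∫⁻ x, ENNReal.ofReal |h x| ∂ν := by
  have := enorm_integral_le_lintegral_enorm (μ := ν) h
  simpa only [← ofReal_norm, Real.norm_eq_abs] using this

theorem weightedForm_le (hn : 2 ≤ n) (hs : 0 < s) (hs1 : s < 1) (hΛ : 1 ≤ Λ) (hp : 1 < p)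
    (hK : KernelBounds n Λ s p K) (hΦ : PhiBounds Λ p Φ) {Ω : Set (Rn n)} {z₀ : Rn n}
    {r r' m : ℝ} (hr : r < r') (hΩ : closedBall z₀ r' ⊆ Ω) {v f : Rn n → ℝ} (hv : Measurable v)
    (hve : energy n s p v < ⊤) (hvp : ∫⁻ x, ENNReal.ofReal (|v x| ^ p) < ⊤)
    (hf : Continuous f) (hfc : HasCompactSupport f)
    (hweak : ∀ φ : Rn n → ℝ, IsTestFun n Ω φ → nonlocalForm n Φ K v φ = ∫ x, φ x * f x)
    {η : Rn n → ℝ} {L : ℝ≥0} (hη : LipschitzWith L η) (h0 : ∀ x, 0 ≤ η x) (h1 : ∀ x, η x ≤ 1)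
    (hηs : ∀ x, x ∉ closedBall z₀ r → η x = 0)
    {ψ : ℝ → ℝ} (hψ0 : ψ 0 = 0) (hψm : Monotone ψ) (hψ : ∀ a b, |ψ a - ψ b| ≤ |a - b|)
    (hψb : ∀ t, |ψ t| ≤ m) :
    weightedForm n s p η ψ v ≤ ENNReal.ofReal (2 * Λ ^ 2 * m) *
      ((∫⁻ x in closedBall z₀ r, ENNReal.ofReal |f x|) +
        ENNReal.ofReal (Λ ^ 2) * cutoffError n s p η v) := by
  have hm : 0 ≤ m := (abs_nonneg _).trans (hψb 0)
  have hηm : Measurable η := hη.continuous.measurable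
  have hψme : Measurable ψ := hψm.measurable
  have hψv : Measurable fun x => ψ (v x) := hψme.comp hv
  set φ : Rn n → ℝ := fun x => η x * ψ (v x) with hφ
  have hφm : Measurable φ := hηm.mul hψv
  have hφb : ∀ x, |φ x| ≤ m := fun x => by
    rw [hφ, abs_mul, abs_of_nonneg (h0 x)]
    exact (mul_le_of_le_one_left (abs_nonneg _) (h1 x)).trans (hψb _)
  have hφe := energy_cutoff_mul_lt_top hn hs hs1 hp hη h0 h1 hψ0 hψ hv hve hvp
  have hform := weak_form_extended hΛ hp hK hΦ hr hΩ hv hve hf hfc hweak hφm hφb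
    (fun x hx => by simp [hφ, hηs x hx]) hφe
  have i1 := integrable_form hΛ hp hK hΦ hv hφm hve hφe
  have i2 : Integrable (fun z : Rn n × Rn n => (η z.1 + η z.2) / 2 *
      (Φ (v z.1 - v z.2) * (ψ (v z.1) - ψ (v z.2)) * K z.1 z.2)) (volume.prod volume) := by
    refine (integrable_form hΛ hp hK hΦ hv hψv hve
      ((energy_comp_le hp hψ v).trans_lt hve)).bdd_mul (c := 1)
      (Measurable.aestronglyMeasurable (by fun_prop)) (.of_forall fun z => ?_)
    rw [Real.norm_eq_abs, abs_of_nonneg (by have := h0 z.1; have := h0 z.2; positivity)]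
    linarith [h1 z.1, h1 z.2]
  have hsplit : ∫ z : Rn n × Rn n, (η z.1 + η z.2) / 2 *
      (Φ (v z.1 - v z.2) * (ψ (v z.1) - ψ (v z.2)) * K z.1 z.2) ∂(volume.prod volume) =
      (∫ x, φ x * f x) - ∫ z : Rn n × Rn n, (ψ (v z.1) + ψ (v z.2)) / 2 *
        (Φ (v z.1 - v z.2) * (η z.1 - η z.2) * K z.1 z.2) ∂(volume.prod volume) := by
    rw [← hform, eq_sub_iff_add_eq', ← eq_sub_iff_add_eq, ← integral_sub i1 i2]
    refine integral_congr_ae (.of_forall fun z => ?_)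
    simp only [hφ]
    ring
  have hdata : ENNReal.ofReal |∫ x, φ x * f x| ≤
      ENNReal.ofReal m * ∫⁻ x in closedBall z₀ r, ENNReal.ofReal |f x| := by
    refine (ofReal_abs_integral_le _).trans ?_
    rw [← lintegral_const_mul' _ _ ENNReal.ofReal_ne_top,
      ← lintegral_indicator isClosed_closedBall.measurableSet]
    refine lintegral_mono fun x => ?_
    by_cases hx : x ∈ closedBall z₀ r
    · rw [indicator_of_mem hx, ← ENNReal.ofReal_mul hm, abs_mul]
      exact ENNReal.ofReal_le_ofReal (mul_le_mul_of_nonneg_right (hφb x) (abs_nonneg _))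
    · simp [hφ, hηs x hx]
  have herr : ENNReal.ofReal |∫ z : Rn n × Rn n, (ψ (v z.1) + ψ (v z.2)) / 2 *
        (Φ (v z.1 - v z.2) * (η z.1 - η z.2) * K z.1 z.2) ∂(volume.prod volume)| ≤
      ENNReal.ofReal m * (ENNReal.ofReal (Λ ^ 2) * cutoffError n s p η v) := by
    refine (ofReal_abs_integral_le _).trans ?_
    rw [cutoffError, ← lintegral_const_mul' _ _ ENNReal.ofReal_ne_top,
      ← lintegral_const_mul' _ _ ENNReal.ofReal_ne_top]
    refine lintegral_mono fun z => ?_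
    rw [← ENNReal.ofReal_mul (by positivity), ← ENNReal.ofReal_mul hm, abs_mul]
    refine ENNReal.ofReal_le_ofReal (mul_le_mul ?_ (abs_form_le hΛ hK hΦ _ η _ _)
      (abs_nonneg _) hm)
    have a1 := abs_le.1 (hψb (v z.1))
    have a2 := abs_le.1 (hψb (v z.2))
    exact abs_le.2 ⟨by linarith, by linarith⟩
  have hnn : ∀ z : Rn n × Rn n, ((Λ ^ 2)⁻¹ / 2) * ((η z.1 + η z.2) * (|v z.1 - v z.2| ^ (p - 1) *
      |ψ (v z.1) - ψ (v z.2)| / ‖z.1 - z.2‖ ^ ((n : ℝ) + s * p))) ≤ (η z.1 + η z.2) / 2 *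
      (Φ (v z.1 - v z.2) * (ψ (v z.1) - ψ (v z.2)) * K z.1 z.2) := fun z => by
    have h2 : 0 ≤ (η z.1 + η z.2) / 2 := by have := h0 z.1; have := h0 z.2; positivity
    calc _ = (η z.1 + η z.2) / 2 * ((Λ ^ 2)⁻¹ * (|v z.1 - v z.2| ^ (p - 1) *
          |ψ (v z.1) - ψ (v z.2)| / ‖z.1 - z.2‖ ^ ((n : ℝ) + s * p))) := by ring
      _ ≤ _ := mul_le_mul_of_nonneg_left (le_form_of_monotone hΛ hp hK hΦ hψm v _ _) h2
  have hlow : ENNReal.ofReal ((Λ ^ 2)⁻¹ / 2) * weightedForm n s p η ψ v ≤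
      ENNReal.ofReal (∫ z : Rn n × Rn n, (η z.1 + η z.2) / 2 *
      (Φ (v z.1 - v z.2) * (ψ (v z.1) - ψ (v z.2)) * K z.1 z.2) ∂(volume.prod volume)) := by
    rw [ofReal_integral_eq_lintegral_ofReal i2 (.of_forall fun z => le_trans ?_ (hnn z)),
      weightedForm, ← lintegral_const_mul' _ _ ENNReal.ofReal_ne_top]
    · refine lintegral_mono fun z => ?_
      rw [← ENNReal.ofReal_mul (by positivity)]
      exact ENNReal.ofReal_le_ofReal (hnn z)
    · have := h0 z.1; have := h0 z.2
      simp only [Pi.zero_apply]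
      positivity
  have hup : ENNReal.ofReal ((Λ ^ 2)⁻¹ / 2) * weightedForm n s p η ψ v ≤ ENNReal.ofReal m *
      ((∫⁻ x in closedBall z₀ r, ENNReal.ofReal |f x|) +
        ENNReal.ofReal (Λ ^ 2) * cutoffError n s p η v) := by
    rw [mul_add]
    refine hlow.trans (le_trans ?_ (add_le_add hdata herr))
    rw [hsplit, ← ENNReal.ofReal_add (abs_nonneg _) (abs_nonneg _)]
    exact ENNReal.ofReal_le_ofReal ((le_abs_self _).trans (abs_sub _ _))
  calc weightedForm n s p η ψ v
      = ENNReal.ofReal (2 * Λ ^ 2) * (ENNReal.ofReal ((Λ ^ 2)⁻¹ / 2) *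
          weightedForm n s p η ψ v) := by
        rw [← mul_assoc, ← ENNReal.ofReal_mul (by positivity)]
        have : 2 * Λ ^ 2 * ((Λ ^ 2)⁻¹ / 2) = 1 := by field_simp
        rw [this, ENNReal.ofReal_one, one_mul]
    _ ≤ _ := by
        rw [ENNReal.ofReal_mul (by positivity) (q := m), mul_assoc]
        exact mul_le_mul_right hup _

/-- The piecewise linear cutoff equal to `1` on `ball z ρ` and vanishing off `closedBall z (2 * ρ)`. -/
def cutoff (z : Rn n) (ρ : ℝ) (x : Rn n) : ℝ := max 0 (min 1 (2 - dist x z / ρ))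

theorem cutoff_nonneg (z : Rn n) (ρ : ℝ) (x : Rn n) : 0 ≤ cutoff z ρ x := le_max_left _ _

theorem cutoff_le_one (z : Rn n) (ρ : ℝ) (x : Rn n) : cutoff z ρ x ≤ 1 :=
  max_le zero_le_one (min_le_left _ _)

theorem cutoff_eq_one {z : Rn n} {ρ : ℝ} (hρ : 0 < ρ) {x : Rn n} (hx : x ∈ ball z ρ) :
    cutoff z ρ x = 1 := by
  have : dist x z / ρ ≤ 1 := (div_le_one hρ).2 (mem_ball.1 hx).le
  rw [cutoff, min_eq_left (by linarith), max_eq_right zero_le_one]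

theorem cutoff_eq_zero {z : Rn n} {ρ : ℝ} (hρ : 0 < ρ) {x : Rn n} (hx : x ∉ closedBall z (2 * ρ)) :
    cutoff z ρ x = 0 := by
  have : 2 ≤ dist x z / ρ := (le_div_iff₀ hρ).2 (not_le.1 fun h => hx (mem_closedBall.2 h)).le
  exact max_eq_left ((min_le_right _ _).trans (by linarith))

theorem lipschitzWith_cutoff (z : Rn n) {ρ : ℝ} (hρ : 0 < ρ) :
    LipschitzWith (ρ⁻¹).toNNReal (cutoff z ρ) := by
  have h : LipschitzWith (ρ⁻¹).toNNReal fun x : Rn n => 2 - dist x z / ρ :=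
    LipschitzWith.of_dist_le_mul fun x y => by
      rw [Real.coe_toNNReal _ (by positivity), Real.dist_eq, sub_sub_sub_cancel_left, ← sub_div,
        abs_div, abs_of_pos hρ, div_eq_inv_mul, abs_sub_comm]
      gcongr
      exact abs_dist_sub_le x y z
  exact (h.const_min 1).const_max 0

theorem lipschitzWith_cutoff_rpow (hp : 1 < p) (z : Rn n) {ρ : ℝ} (hρ : 0 < ρ) :
    LipschitzWith (p * ρ⁻¹).toNNReal fun x => cutoff z ρ x ^ p :=
  LipschitzWith.of_dist_le_mul fun x y => by
    rw [Real.coe_toNNReal _ (by positivity), Real.dist_eq]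
    have h := (lipschitzWith_cutoff z hρ).dist_le_mul x y
    rw [Real.coe_toNNReal _ (by positivity), Real.dist_eq] at h
    have h2 := rpow_sub_rpow_le (cutoff_nonneg z ρ x) (cutoff_nonneg z ρ y) hp
    have h3 : max (cutoff z ρ x) (cutoff z ρ y) ^ (p - 1) ≤ 1 :=
      Real.rpow_le_one (le_max_of_le_left (cutoff_nonneg _ _ _))
        (max_le (cutoff_le_one _ _ _) (cutoff_le_one _ _ _)) (by linarith)
    calc _ ≤ _ := h2
      _ ≤ p * (ρ⁻¹ * dist x y * 1) := by
        gcongr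
        exact Real.rpow_nonneg (le_max_of_le_left (cutoff_nonneg _ _ _)) _
      _ = _ := by ring

theorem one_add_abs_add_abs_rpow_le (a b : ℝ) {q : ℝ} (hq : 0 < q) :
    (1 + |a| + |b|) ^ q ≤ 3 ^ q * ((1 + |a| ^ q) + (1 + |b| ^ q)) := by
  set t := max 1 (max |a| |b|) with ht
  have h1 : 1 ≤ t := le_max_left _ _
  have h2 : |a| ≤ t := (le_max_left _ _).trans (le_max_right _ _)
  have h3 : |b| ≤ t := (le_max_right _ _).trans (le_max_right _ _)
  have ha : 0 ≤ |a| ^ q := by positivity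
  have hb : 0 ≤ |b| ^ q := by positivity
  calc (1 + |a| + |b|) ^ q ≤ (3 * t) ^ q := by gcongr; linarith
    _ = 3 ^ q * t ^ q := Real.mul_rpow (by norm_num) (by linarith)
    _ ≤ _ := by
        gcongr
        rcases max_choice 1 (max |a| |b|) with h | h
        · rw [ht, h, Real.one_rpow]; linarith
        · rcases max_choice |a| |b| with h' | h' <;> rw [ht, h, h'] <;> linarith

theorem near_integrand_le (hp : 1 < p) {δ q ε : ℝ} (hq : (1 + δ) * (p - 1) = q) (hq0 : 0 < q)
    (hε : 0 < ε) (a b : ℝ) {ζ₁ ζ₂ : ℝ} (h1 : 0 ≤ ζ₁) (h2 : 0 ≤ ζ₂) :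
    |a - b| ^ (p - 1) * |ζ₁ ^ p - ζ₂ ^ p| ≤
      p * ε * ((ζ₁ ^ p + ζ₂ ^ p) * (|a - b| ^ p * (1 + |a| + |b|) ^ (-(1 + δ)))) +
      p * ε ^ (-(p - 1)) * 3 ^ q * (((1 + |a| ^ q) + (1 + |b| ^ q)) * |ζ₁ - ζ₂| ^ p) := by
  have hM : 0 < 1 + |a| + |b| := by positivity
  have hy := weighted_young (a := |a - b|) (m := max ζ₁ ζ₂) (d := |ζ₁ - ζ₂|) (σ := 1 + δ)
    (abs_nonneg _) (le_max_of_le_left h1) (abs_nonneg _) hM hε hp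
  rw [hq] at hy
  have hmax : max ζ₁ ζ₂ ^ p ≤ ζ₁ ^ p + ζ₂ ^ p := by
    have := Real.rpow_nonneg h1 p
    have := Real.rpow_nonneg h2 p
    rcases max_choice ζ₁ ζ₂ with h | h <;> rw [h] <;> linarith
  calc |a - b| ^ (p - 1) * |ζ₁ ^ p - ζ₂ ^ p|
      ≤ |a - b| ^ (p - 1) * (p * (|ζ₁ - ζ₂| * max ζ₁ ζ₂ ^ (p - 1))) := by
        gcongr; exact rpow_sub_rpow_le h1 h2 hp
    _ = p * (|a - b| ^ (p - 1) * (|ζ₁ - ζ₂| * max ζ₁ ζ₂ ^ (p - 1))) := by ring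
    _ ≤ p * (ε * (max ζ₁ ζ₂ ^ p * (|a - b| ^ p * (1 + |a| + |b|) ^ (-(1 + δ)))) +
          ε ^ (-(p - 1)) * (|ζ₁ - ζ₂| ^ p * (1 + |a| + |b|) ^ q)) := by gcongr
    _ ≤ p * (ε * ((ζ₁ ^ p + ζ₂ ^ p) * (|a - b| ^ p * (1 + |a| + |b|) ^ (-(1 + δ)))) +
          ε ^ (-(p - 1)) * (|ζ₁ - ζ₂| ^ p * (3 ^ q * ((1 + |a| ^ q) + (1 + |b| ^ q))))) := by
        gcongr
        exact one_add_abs_add_abs_rpow_le a b hq0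
    _ = _ := by ring

theorem far_integrand_le (hp : 1 < p) {N : ℝ} (hN : 0 ≤ N) {z x y : Rn n} {ρ R : ℝ} (hρ : 0 < ρ)
    (hR : 4 * ρ ≤ R) (hx : x ∈ closedBall z (2 * ρ)) (hy : y ∉ ball z R) (a b : ℝ) :
    |a - b| ^ (p - 1) / ‖x - y‖ ^ N ≤
      2 ^ (p - 1) * 2 ^ N * (|a| ^ (p - 1) * (1 / ‖y - z‖ ^ N) + |b| ^ (p - 1) / ‖y - z‖ ^ N) := by
  rw [mem_closedBall, dist_eq_norm] at hx
  rw [mem_ball, dist_eq_norm, not_lt] at hy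
  have h1 : ‖y - z‖ / 2 ≤ ‖x - y‖ := by
    have : ‖y - z‖ ≤ ‖x - y‖ + ‖x - z‖ := by
      rw [norm_sub_rev x y]; exact norm_sub_le_norm_sub_add_norm_sub y x z
    linarith
  have h0 : 0 < ‖y - z‖ := by linarith
  calc |a - b| ^ (p - 1) / ‖x - y‖ ^ N
      ≤ (2 ^ (p - 1) * (|a| ^ (p - 1) + |b| ^ (p - 1))) / (‖y - z‖ / 2) ^ N := by
        gcongr; exact abs_sub_rpow_le a b (by linarith)
    _ = _ := by
        rw [Real.div_rpow h0.le (by norm_num)]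
        field_simp

theorem lintegral_add_mul_symm_le {W : Rn n → ℝ≥0∞} (hW : Measurable W) {k : Rn n × Rn n → ℝ≥0∞}
    (hk : Measurable k) (hks : ∀ w, k w.swap = k w) {C : ℝ≥0∞} (hC : C ≠ ⊤)
    (hkC : ∀ x, ∫⁻ y, k (x, y) ≤ C) :
    ∫⁻ w : Rn n × Rn n, (W w.1 + W w.2) * k w ∂(volume.prod volume) ≤
      2 * ((∫⁻ x, W x) * C) := by
  have h1 : ∫⁻ w : Rn n × Rn n, W w.1 * k w ∂(volume.prod volume) ≤ (∫⁻ x, W x) * C := by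
    rw [lintegral_prod _ (Measurable.aemeasurable (by fun_prop)), ← lintegral_mul_const' _ _ hC]
    refine lintegral_mono fun x => ?_
    dsimp only
    rw [lintegral_const_mul _ (by fun_prop)]
    exact mul_le_mul_right (hkC x) _
  have h2 : ∫⁻ w : Rn n × Rn n, W w.2 * k w ∂(volume.prod volume) =
      ∫⁻ w : Rn n × Rn n, W w.1 * k w ∂(volume.prod volume) := by
    rw [← lintegral_prod_swap]
    simp only [hks, Prod.snd_swap]
  simp only [add_mul]
  rw [lintegral_add_left (by fun_prop), h2, two_mul]
  exact add_le_add h1 h1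

theorem abs_sub_le_one {a b : ℝ} (ha : 0 ≤ a) (ha1 : a ≤ 1) (hb : 0 ≤ b) (hb1 : b ≤ 1) :
    |a - b| ≤ 1 := abs_le.2 ⟨by linarith, by linarith⟩

theorem cutoffError_le (hn : 2 ≤ n) (hs : 0 < s) (hs1 : s < 1) (hp : 1 < p) {δ q : ℝ}
    (hδ : 0 < δ) (hδ1 : δ ≤ 1) (hq : (1 + δ) * (p - 1) = q) (z₀ : Rn n) {ρ R : ℝ} (hρ : 0 < ρ)
    (hR : 4 * ρ ≤ R) {A : ℝ≥0∞} (hA : A < ⊤) {ε : ℝ} (hε : 0 < ε) :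
    ∃ X : ℝ≥0∞, X < ⊤ ∧ ∀ v : Rn n → ℝ, Measurable v →
      (∫⁻ x in ball z₀ R, ENNReal.ofReal (|v x| ^ q)) ≤ A →
      (∫⁻ x in (ball z₀ R)ᶜ, ENNReal.ofReal (|v x| ^ (p - 1) / ‖x - z₀‖ ^ ((n : ℝ) + s * p))) ≤ A →
      cutoffError n s p (fun x => cutoff z₀ ρ x ^ p) v ≤ ENNReal.ofReal (p * ε * δ⁻¹) *
        weightedForm n s p (fun x => cutoff z₀ ρ x ^ p) (satur δ) v + X := by
  obtain ⟨C, hC, hCb⟩ := lintegral_cutoff_le n hn hs hs1 hp (lipschitzWith_cutoff z₀ hρ)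
    (cutoff_nonneg z₀ ρ) (cutoff_le_one z₀ ρ)
  have hpq : p - 1 ≤ q := by nlinarith
  have hq0 : 0 < q := by linarith
  set N : ℝ := (n : ℝ) + s * p with hN
  have hN0 : 0 ≤ N := by positivity
  have hT0 := lintegral_compl_ball_lt_top n hn hs hs1 hp (R := R) (by linarith) z₀
  rw [← hN] at hT0
  set ζ := cutoff z₀ ρ with hζ
  have hζm : Measurable ζ := (lipschitzWith_cutoff z₀ hρ).continuous.measurable
  set c₁ : ℝ := p * ε ^ (-(p - 1)) * 3 ^ q with hc₁
  set c₂ : ℝ := 2 ^ (p - 1) * 2 ^ N with hc₂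
  have hc₁0 : 0 ≤ c₁ := by positivity
  have hc₂0 : 0 ≤ c₂ := by positivity
  have hBR : volume (ball z₀ R) < ⊤ := measure_ball_lt_top
  have hBρ : volume (closedBall z₀ (2 * ρ)) < ⊤ := (isCompact_closedBall _ _).measure_lt_top
  refine ⟨ENNReal.ofReal c₁ * (2 * ((volume (ball z₀ R) + A) * C)) + ENNReal.ofReal c₂ *
    (2 * ((volume (ball z₀ R) + A) *
      (∫⁻ y in (ball z₀ R)ᶜ, ENNReal.ofReal (1 / ‖y - z₀‖ ^ N)) +
        volume (closedBall z₀ (2 * ρ)) * A)), ?_, fun v hv hvA hvT => ?_⟩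
  · have h1 : volume (ball z₀ R) + A < ⊤ := ENNReal.add_lt_top.2 ⟨hBR, hA⟩
    exact ENNReal.add_lt_top.2 ⟨ENNReal.mul_lt_top ENNReal.ofReal_lt_top
      (ENNReal.mul_lt_top (by simp) (ENNReal.mul_lt_top h1 hC)),
      ENNReal.mul_lt_top ENNReal.ofReal_lt_top (ENNReal.mul_lt_top (by simp)
      (ENNReal.add_lt_top.2 ⟨ENNReal.mul_lt_top h1 hT0, ENNReal.mul_lt_top hBρ hA⟩))⟩
  set W : Rn n → ℝ≥0∞ := (ball z₀ R).indicator fun x => ENNReal.ofReal (1 + |v x| ^ q) with hW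
  set k : Rn n × Rn n → ℝ≥0∞ := fun w =>
    ENNReal.ofReal (|ζ w.1 - ζ w.2| ^ p / ‖w.1 - w.2‖ ^ N) with hk
  set U : Rn n → ℝ≥0∞ :=
    (closedBall z₀ (2 * ρ)).indicator fun x => ENNReal.ofReal (|v x| ^ (p - 1)) with hU
  set I : Rn n → ℝ≥0∞ := (closedBall z₀ (2 * ρ)).indicator 1 with hI
  set T₀ : Rn n → ℝ≥0∞ :=
    (ball z₀ R)ᶜ.indicator fun y => ENNReal.ofReal (1 / ‖y - z₀‖ ^ N) with hT₀
  set T : Rn n → ℝ≥0∞ :=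
    (ball z₀ R)ᶜ.indicator fun y => ENNReal.ofReal (|v y| ^ (p - 1) / ‖y - z₀‖ ^ N) with hT
  have mB : MeasurableSet (ball z₀ R) := measurableSet_ball
  have mC : MeasurableSet (closedBall z₀ (2 * ρ)) := measurableSet_closedBall
  have hWm : Measurable W := Measurable.indicator (by fun_prop) mB
  have hkm : Measurable k := by fun_prop
  have hUm : Measurable U := Measurable.indicator (by fun_prop) mC
  have hIm : Measurable I := measurable_one.indicator mC
  have hT₀m : Measurable T₀ := Measurable.indicator (by fun_prop) mB.compl
  have hTm : Measurable T := Measurable.indicator (by fun_prop) mB.compl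
  have hWi : ∫⁻ x, W x ≤ volume (ball z₀ R) + A := by
    rw [hW, lintegral_indicator mB]
    calc _ = ∫⁻ x in ball z₀ R, (1 + ENNReal.ofReal (|v x| ^ q)) := by
          refine lintegral_congr fun x => ?_
          rw [ENNReal.ofReal_add zero_le_one (by positivity), ENNReal.ofReal_one]
      _ = volume (ball z₀ R) + ∫⁻ x in ball z₀ R, ENNReal.ofReal (|v x| ^ q) := by
          rw [lintegral_add_left measurable_const, setLIntegral_one]
      _ ≤ _ := by gcongr
  have hUi : ∫⁻ x, U x ≤ volume (ball z₀ R) + A := by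
    refine le_trans (lintegral_mono fun x => ?_) hWi
    by_cases hx : x ∈ closedBall z₀ (2 * ρ)
    · have hx' : x ∈ ball z₀ R := closedBall_subset_ball (by linarith) hx
      simp only [hU, hW, indicator_of_mem hx, indicator_of_mem hx']
      refine ENNReal.ofReal_le_ofReal ?_
      rcases le_total |v x| 1 with h | h
      · have := Real.rpow_le_one (abs_nonneg _) h (by linarith : 0 ≤ p - 1)
        have : 0 ≤ |v x| ^ q := by positivity
        linarith
      · have := Real.rpow_le_rpow_of_exponent_le h hpq
        linarith
    · simp [hU, hx]
  have hIi : ∫⁻ x, I x = volume (closedBall z₀ (2 * ρ)) := lintegral_indicator_one mC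
  have hT₀i : ∫⁻ x, T₀ x = ∫⁻ y in (ball z₀ R)ᶜ, ENNReal.ofReal (1 / ‖y - z₀‖ ^ N) :=
    lintegral_indicator mB.compl _
  have hTi : ∫⁻ x, T x ≤ A := by rw [hT, lintegral_indicator mB.compl]; exact hvT
  set H : Rn n × Rn n → ℝ≥0∞ := fun w => U w.1 * T₀ w.2 + I w.1 * T w.2 with hH
  have hHm : Measurable H := by fun_prop
  have hHi : ∫⁻ w, H w ∂(volume.prod volume) ≤ (volume (ball z₀ R) + A) *
      (∫⁻ y in (ball z₀ R)ᶜ, ENNReal.ofReal (1 / ‖y - z₀‖ ^ N)) +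
        volume (closedBall z₀ (2 * ρ)) * A := by
    rw [hH, lintegral_add_left (by fun_prop), lintegral_prod_mul hUm.aemeasurable hT₀m.aemeasurable,
      lintegral_prod_mul hIm.aemeasurable hTm.aemeasurable, hIi, hT₀i]
    gcongr
  have hfar : ∀ x y : Rn n, x ∈ closedBall z₀ (2 * ρ) → y ∉ ball z₀ R →
      ENNReal.ofReal (|v x - v y| ^ (p - 1) * |ζ x ^ p - ζ y ^ p| / ‖x - y‖ ^ N) ≤
        ENNReal.ofReal c₂ * H (x, y) := fun x y hx hy => by
    have hy' : y ∈ (ball z₀ R)ᶜ := hy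
    simp only [hH, hU, hI, hT₀, hT, indicator_of_mem hx, indicator_of_mem hy', Pi.one_apply,
      one_mul]
    rw [← ENNReal.ofReal_mul (by positivity), ← ENNReal.ofReal_add (by positivity) (by positivity),
      ← ENNReal.ofReal_mul hc₂0]
    refine ENNReal.ofReal_le_ofReal (le_trans ?_ (far_integrand_le hp hN0 hρ hR hx hy _ _))
    refine div_le_div_of_nonneg_right (mul_le_of_le_one_right (by positivity) ?_) (by positivity)
    have h0 := fun w => cutoff_nonneg z₀ ρ w
    have h1 := fun w => cutoff_le_one z₀ ρ w
    exact abs_sub_le_one (Real.rpow_nonneg (h0 x) _) (Real.rpow_le_one (h0 x) (h1 x) (by linarith))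
      (Real.rpow_nonneg (h0 y) _) (Real.rpow_le_one (h0 y) (h1 y) (by linarith))
  have hpt : ∀ w : Rn n × Rn n,
      ENNReal.ofReal (|v w.1 - v w.2| ^ (p - 1) * |ζ w.1 ^ p - ζ w.2 ^ p| / ‖w.1 - w.2‖ ^ N) ≤
      ENNReal.ofReal (p * ε * δ⁻¹) * ENNReal.ofReal ((ζ w.1 ^ p + ζ w.2 ^ p) *
        (|v w.1 - v w.2| ^ (p - 1) * |satur δ (v w.1) - satur δ (v w.2)| / ‖w.1 - w.2‖ ^ N)) +
      (ENNReal.ofReal c₁ * ((W w.1 + W w.2) * k w) + ENNReal.ofReal c₂ * (H w + H w.swap)) := by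
    rintro ⟨x, y⟩
    dsimp only [Prod.swap]
    by_cases h1 : x ∈ closedBall z₀ (2 * ρ) ∧ y ∉ ball z₀ R
    · exact (hfar x y h1.1 h1.2).trans ((mul_le_mul_right le_self_add _).trans
        (le_add_self.trans le_add_self))
    by_cases h2 : y ∈ closedBall z₀ (2 * ρ) ∧ x ∉ ball z₀ R
    · rw [abs_sub_comm, abs_sub_comm (ζ x ^ p), norm_sub_rev]
      exact (hfar y x h2.1 h2.2).trans ((mul_le_mul_right le_add_self _).trans
        (le_add_self.trans le_add_self))
    by_cases h3 : x ∈ ball z₀ R ∧ y ∈ ball z₀ R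
    · refine le_trans ?_ (add_le_add_right le_self_add _)
      simp only [hW, hk, indicator_of_mem h3.1, indicator_of_mem h3.2]
      have hsat := le_abs_satur_sub hδ hδ1 (v x) (v y)
      have hx0 := Real.rpow_nonneg (cutoff_nonneg z₀ ρ x) p
      have hy0 := Real.rpow_nonneg (cutoff_nonneg z₀ ρ y) p
      rw [← hζ] at hx0 hy0
      rw [← ENNReal.ofReal_add (by positivity) (by positivity),
        ← ENNReal.ofReal_mul (by positivity), ← ENNReal.ofReal_mul (by positivity),
        ← ENNReal.ofReal_mul (by positivity), ← ENNReal.ofReal_add (by positivity) (by positivity)]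
      refine ENNReal.ofReal_le_ofReal ?_
      have hnear := near_integrand_le hp hq hq0 hε (v x) (v y) (cutoff_nonneg z₀ ρ x)
        (cutoff_nonneg z₀ ρ y)
      rw [← hζ] at hnear
      have habs : |v x - v y| ^ p = |v x - v y| ^ (p - 1) * |v x - v y| := by
        rcases (abs_nonneg (v x - v y)).eq_or_lt with h | h
        · rw [← h, mul_zero, Real.zero_rpow (by linarith)]
        · rw [Real.rpow_sub_one h.ne', div_mul_cancel₀ _ h.ne']
      have hD : |v x - v y| ^ p * (1 + |v x| + |v y|) ^ (-(1 + δ)) ≤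
          δ⁻¹ * (|v x - v y| ^ (p - 1) * |satur δ (v x) - satur δ (v y)|) := by
        rw [← div_eq_inv_mul, le_div_iff₀ hδ, habs]
        calc _ = |v x - v y| ^ (p - 1) *
              (δ * (|v x - v y| * (1 + |v x| + |v y|) ^ (-(1 + δ)))) := by ring
          _ ≤ _ := by gcongr
      calc _ ≤ (p * ε * ((ζ x ^ p + ζ y ^ p) * (δ⁻¹ * (|v x - v y| ^ (p - 1) *
              |satur δ (v x) - satur δ (v y)|))) +
            c₁ * (((1 + |v x| ^ q) + (1 + |v y| ^ q)) * |ζ x - ζ y| ^ p)) / ‖x - y‖ ^ N := by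
            refine div_le_div_of_nonneg_right (hnear.trans ?_) (by positivity)
            gcongr
        _ = _ := by ring
    · have hsub : closedBall z₀ (2 * ρ) ⊆ ball z₀ R := closedBall_subset_ball (by linarith)
      have hx : x ∉ closedBall z₀ (2 * ρ) := fun hx => h3
        ⟨hsub hx, by by_contra hy; exact h1 ⟨hx, hy⟩⟩
      have hy : y ∉ closedBall z₀ (2 * ρ) := fun hy => h3
        ⟨by by_contra hx; exact h2 ⟨hy, hx⟩, hsub hy⟩
      simp [hζ, cutoff_eq_zero hρ hx, cutoff_eq_zero hρ hy]
  have hswap : ∫⁻ w : Rn n × Rn n, H w.swap ∂(volume.prod volume) =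
      ∫⁻ w, H w ∂(volume.prod volume) := lintegral_prod_swap _
  have hPm : Measurable fun w : Rn n × Rn n => ENNReal.ofReal ((ζ w.1 ^ p + ζ w.2 ^ p) *
      (|v w.1 - v w.2| ^ (p - 1) * |satur δ (v w.1) - satur δ (v w.2)| / ‖w.1 - w.2‖ ^ N)) := by
    have : Measurable (satur δ) := (monotone_satur hδ hδ1).measurable
    fun_prop
  calc _ ≤ _ := lintegral_mono hpt
    _ = ENNReal.ofReal (p * ε * δ⁻¹) *
        weightedForm n s p (fun x => ζ x ^ p) (satur δ) v +
        (ENNReal.ofReal c₁ * ∫⁻ w : Rn n × Rn n, (W w.1 + W w.2) * k w ∂(volume.prod volume) +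
          ENNReal.ofReal c₂ * (∫⁻ w, H w ∂(volume.prod volume) +
            ∫⁻ w, H w ∂(volume.prod volume))) := by
      rw [lintegral_add_left (by fun_prop), lintegral_add_left (by fun_prop),
        lintegral_const_mul' _ _ ENNReal.ofReal_ne_top,
        lintegral_const_mul' _ _ ENNReal.ofReal_ne_top,
        lintegral_const_mul' _ _ ENNReal.ofReal_ne_top, lintegral_add_left hHm, hswap, weightedForm]
    _ ≤ _ := by
      gcongr
      · refine (lintegral_add_mul_symm_le hWm hkm (fun w => ?_) hC.ne fun x => ?_).trans
          (by gcongr)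
        · simp only [hk, Prod.fst_swap, Prod.snd_swap]
          rw [abs_sub_comm, norm_sub_rev]
        · exact hCb x
      · rw [← two_mul]
        gcongr

/-- Finite energy weak solutions with a bound on the datum, on the `L^q` norm and on the tail. -/
structure IsBoundedSol (n : ℕ) (Φ : ℝ → ℝ) (K : Rn n → Rn n → ℝ) (s p : ℝ) (Ω : Set (Rn n))
    (q : ℝ) (z₀ : Rn n) (R : ℝ) (A : ℝ≥0∞) (v f : Rn n → ℝ) : Prop where
  measurable : Measurable v
  energy_lt_top : energy n s p v < ⊤
  lintegral_lt_top : ∫⁻ x, ENNReal.ofReal (|v x| ^ p) < ⊤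
  continuous : Continuous f
  hasCompactSupport : HasCompactSupport f
  weak : ∀ φ : Rn n → ℝ, IsTestFun n Ω φ → nonlocalForm n Φ K v φ = ∫ x, φ x * f x
  lintegral_le : ∫⁻ x in ball z₀ R, ENNReal.ofReal (|v x| ^ q) ≤ A
  tail_le : ∫⁻ x in (ball z₀ R)ᶜ,
    ENNReal.ofReal (|v x| ^ (p - 1) / ‖x - z₀‖ ^ ((n : ℝ) + s * p)) ≤ A
  datum_le : ∫⁻ x in ball z₀ R, ENNReal.ofReal |f x| ≤ A

theorem weightedForm_lt_top (hp : 1 < p) {η : Rn n → ℝ} (h1 : ∀ x, η x ≤ 1) {ψ : ℝ → ℝ}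
    (hψ : ∀ a b, |ψ a - ψ b| ≤ |a - b|) {v : Rn n → ℝ} (hve : energy n s p v < ⊤) :
    weightedForm n s p η ψ v < ⊤ := by
  have : weightedForm n s p η ψ v ≤ ENNReal.ofReal 2 * energy n s p v := by
    rw [energy, ← lintegral_const_mul' _ _ ENNReal.ofReal_ne_top]
    refine lintegral_mono fun w => ?_
    rw [← ENNReal.ofReal_mul (by positivity)]
    refine ENNReal.ofReal_le_ofReal (mul_le_mul (by linarith [h1 w.1, h1 w.2]) ?_ (by positivity)
      (by positivity))
    rw [← rpow_sub_one_mul_self (abs_nonneg _) hp]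
    refine div_le_div_of_nonneg_right ?_ (by positivity)
    exact mul_le_mul_of_nonneg_left (hψ _ _) (by positivity)
  exact this.trans_lt (ENNReal.mul_lt_top ENNReal.ofReal_lt_top hve)

theorem IsBoundedSol.weightedForm_le {Ω : Set (Rn n)} {q : ℝ} {z₀ : Rn n} {ρ R : ℝ} {A : ℝ≥0∞}
    {v f : Rn n → ℝ} (h : IsBoundedSol n Φ K s p Ω q z₀ R A v f)
    (hn : 2 ≤ n) (hs : 0 < s) (hs1 : s < 1) (hΛ : 1 ≤ Λ) (hp : 1 < p)
    (hK : KernelBounds n Λ s p K) (hΦ : PhiBounds Λ p Φ) (hρ : 0 < ρ) (hR : 4 * ρ ≤ R)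
    (hΩ : closedBall z₀ (3 * ρ) ⊆ Ω) {ψ : ℝ → ℝ} {m : ℝ} (hψ0 : ψ 0 = 0) (hψm : Monotone ψ)
    (hψ : ∀ a b, |ψ a - ψ b| ≤ |a - b|) (hψb : ∀ t, |ψ t| ≤ m) :
    weightedForm n s p (fun x => cutoff z₀ ρ x ^ p) ψ v ≤ ENNReal.ofReal (2 * Λ ^ 2 * m) *
      (A + ENNReal.ofReal (Λ ^ 2) * cutoffError n s p (fun x => cutoff z₀ ρ x ^ p) v) := by
  refine (Marcinkiewicz.weightedForm_le hn hs hs1 hΛ hp hK hΦ (r := 2 * ρ) (by linarith) hΩ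
    h.measurable h.energy_lt_top h.lintegral_lt_top h.continuous h.hasCompactSupport h.weak
    (lipschitzWith_cutoff_rpow hp z₀ hρ) (fun x => Real.rpow_nonneg (cutoff_nonneg _ _ _) _)
    (fun x => Real.rpow_le_one (cutoff_nonneg _ _ _) (cutoff_le_one _ _ _) (by linarith))
    (fun x hx => by rw [cutoff_eq_zero hρ hx, Real.zero_rpow (by linarith)])
    hψ0 hψm hψ hψb).trans ?_
  gcongr
  exact (lintegral_mono_set (closedBall_subset_ball (by linarith))).trans h.datum_le

theorem exists_cutoffError_le (hn : 2 ≤ n) (hs : 0 < s) (hs1 : s < 1) (hΛ : 1 ≤ Λ) (hp : 1 < p)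
    (hK : KernelBounds n Λ s p K) (hΦ : PhiBounds Λ p Φ) {Ω : Set (Rn n)} {δ q : ℝ}
    (hδ : 0 < δ) (hδ1 : δ ≤ 1) (hq : (1 + δ) * (p - 1) = q) (z₀ : Rn n) {ρ R : ℝ} (hρ : 0 < ρ)
    (hR : 4 * ρ ≤ R) (hΩ : closedBall z₀ (3 * ρ) ⊆ Ω) {A : ℝ≥0∞} (hA : A < ⊤) :
    ∃ C : ℝ≥0∞, C < ⊤ ∧ ∀ v f : Rn n → ℝ, IsBoundedSol n Φ K s p Ω q z₀ R A v f →
      cutoffError n s p (fun x => cutoff z₀ ρ x ^ p) v ≤ C := by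
  have hε : 0 < δ / (4 * p * Λ ^ 4) := by positivity
  obtain ⟨X, hX, hXb⟩ := cutoffError_le hn hs hs1 hp hδ hδ1 hq z₀ hρ hR hA hε
  set c : ℝ := p * (δ / (4 * p * Λ ^ 4)) * δ⁻¹ with hc
  have hc0 : 0 ≤ c := by positivity
  refine ⟨2 * (ENNReal.ofReal c * (ENNReal.ofReal (2 * Λ ^ 2 * 1) * A) + X),
    ENNReal.mul_lt_top (by simp) (ENNReal.add_lt_top.2 ⟨ENNReal.mul_lt_top ENNReal.ofReal_lt_top
      (ENNReal.mul_lt_top ENNReal.ofReal_lt_top hA), hX⟩), fun v f h => ?_⟩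
  have h1 := hXb v h.measurable h.lintegral_le h.tail_le
  have h2 := h.weightedForm_le hn hs hs1 hΛ hp hK hΦ hρ hR hΩ (satur_zero δ)
    (monotone_satur hδ hδ1) (abs_satur_sub_le hδ hδ1) (fun t => abs_satur_le hδ)
  have hfin := weightedForm_lt_top hp (η := fun x => cutoff z₀ ρ x ^ p)
    (fun x => Real.rpow_le_one (cutoff_nonneg _ _ _) (cutoff_le_one _ _ _) (by linarith))
    (abs_satur_sub_le hδ hδ1) h.energy_lt_top
  set E := cutoffError n s p (fun x => cutoff z₀ ρ x ^ p) v
  have hE : E < ⊤ := h1.trans_lt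
    (ENNReal.add_lt_top.2 ⟨ENNReal.mul_lt_top ENNReal.ofReal_lt_top hfin, hX⟩)
  have hhalf : ENNReal.ofReal c * (ENNReal.ofReal (2 * Λ ^ 2 * 1) *
      (ENNReal.ofReal (Λ ^ 2) * E)) = E / 2 := by
    rw [← mul_assoc, ← mul_assoc, ← ENNReal.ofReal_mul hc0, ← ENNReal.ofReal_mul (by positivity)]
    have : c * (2 * Λ ^ 2 * 1) * Λ ^ 2 = 2⁻¹ := by
      rw [hc]; field_simp; norm_num
    rw [this, ENNReal.ofReal_inv_of_pos two_pos, ENNReal.ofReal_ofNat, mul_comm, div_eq_mul_inv]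
  have h3 : E / 2 + E / 2 ≤
      E / 2 + (ENNReal.ofReal c * (ENNReal.ofReal (2 * Λ ^ 2 * 1) * A) + X) := by
    rw [ENNReal.add_halves]
    calc E ≤ ENNReal.ofReal c * (ENNReal.ofReal (2 * Λ ^ 2 * 1) *
          (A + ENNReal.ofReal (Λ ^ 2) * E)) + X := h1.trans (by gcongr)
      _ = _ := by rw [mul_add, mul_add, hhalf, add_comm (ENNReal.ofReal c * _), add_assoc]
  have h4 := (ENNReal.add_le_add_iff_left (ENNReal.div_lt_top hE.ne two_ne_zero).ne).1 h3
  calc E = 2 * (E / 2) := (ENNReal.mul_div_cancel two_ne_zero (by simp)).symm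
    _ ≤ _ := by gcongr

theorem exists_truncation_energy_le (hn : 2 ≤ n) (hs : 0 < s) (hs1 : s < 1) (hΛ : 1 ≤ Λ)
    (hp : 1 < p) (hK : KernelBounds n Λ s p K) (hΦ : PhiBounds Λ p Φ) {Ω : Set (Rn n)} {δ q : ℝ}
    (hδ : 0 < δ) (hδ1 : δ ≤ 1) (hq : (1 + δ) * (p - 1) = q) (z₀ : Rn n) {ρ R : ℝ} (hρ : 0 < ρ)
    (hR : 4 * ρ ≤ R) (hΩ : closedBall z₀ (3 * ρ) ⊆ Ω) {A : ℝ≥0∞} (hA : A < ⊤) :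
    ∃ C : ℝ≥0∞, C < ⊤ ∧ ∀ v f : Rn n → ℝ, IsBoundedSol n Φ K s p Ω q z₀ R A v f → ∀ k : ℝ, 0 < k →
      ∫⁻ x in ball z₀ ρ, ∫⁻ y in ball z₀ ρ, ENNReal.ofReal
        (|trunc k (v x) - trunc k (v y)| ^ p / ‖x - y‖ ^ ((n : ℝ) + s * p)) ≤
          ENNReal.ofReal k * C := by
  obtain ⟨C, hC, hCb⟩ := exists_cutoffError_le hn hs hs1 hΛ hp hK hΦ hδ hδ1 hq z₀ hρ hR hΩ hA
  refine ⟨ENNReal.ofReal (2 * Λ ^ 2) * (A + ENNReal.ofReal (Λ ^ 2) * C),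
    ENNReal.mul_lt_top ENNReal.ofReal_lt_top (ENNReal.add_lt_top.2
      ⟨hA, ENNReal.mul_lt_top ENNReal.ofReal_lt_top hC⟩), fun v f h k hk => ?_⟩
  have h2 := h.weightedForm_le hn hs hs1 hΛ hp hK hΦ hρ hR hΩ (trunc_zero hk.le)
    (monotone_trunc k) (abs_trunc_sub_le k) (abs_trunc_le hk.le)
  have hTm : Measurable (trunc k) := (monotone_trunc k).measurable
  have hvm := h.measurable
  have h3 : ∫⁻ x in ball z₀ ρ, ∫⁻ y in ball z₀ ρ, ENNReal.ofReal
        (|trunc k (v x) - trunc k (v y)| ^ p / ‖x - y‖ ^ ((n : ℝ) + s * p)) ≤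
      weightedForm n s p (fun x => cutoff z₀ ρ x ^ p) (trunc k) v := by
    have e := lintegral_prod (μ := volume.restrict (ball z₀ ρ)) (ν := volume.restrict (ball z₀ ρ))
      (fun w : Rn n × Rn n => ENNReal.ofReal
        (|trunc k (v w.1) - trunc k (v w.2)| ^ p / ‖w.1 - w.2‖ ^ ((n : ℝ) + s * p)))
      (Measurable.aemeasurable (by fun_prop))
    rw [← e, Measure.prod_restrict]
    refine (setLIntegral_mono' (measurableSet_ball.prod measurableSet_ball) fun w hw => ?_).trans
      (setLIntegral_le_lintegral _ _)
    refine ENNReal.ofReal_le_ofReal ?_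
    dsimp only
    rw [cutoff_eq_one hρ hw.1, cutoff_eq_one hρ hw.2, Real.one_rpow,
      ← rpow_sub_one_mul_self (abs_nonneg _) hp]
    refine (div_le_div_of_nonneg_right ?_ (by positivity)).trans
      (le_mul_of_one_le_left (by positivity) (by norm_num))
    exact mul_le_mul_of_nonneg_right
      (Real.rpow_le_rpow (abs_nonneg _) (abs_trunc_sub_le _ _ _) (by linarith)) (abs_nonneg _)
  calc _ ≤ _ := h3.trans h2
    _ ≤ ENNReal.ofReal (2 * Λ ^ 2 * k) * (A + ENNReal.ofReal (Λ ^ 2) * C) := by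
      gcongr
      exact hCb v f h
    _ = _ := by
      rw [ENNReal.ofReal_mul (by positivity), mul_comm (ENNReal.ofReal (2 * Λ ^ 2)), mul_assoc]

theorem exists_bound_of_levelSet_decay {V k₀ C θ p : ℝ} (hV : 0 ≤ V) (hk₀ : 0 < k₀) (hC : 0 < C)
    (hθ : 0 < θ) (hθ1 : θ < 1) (hp : 1 < p) :
    ∃ M : ℝ, ∀ α : ℝ → ℝ, (∀ k, 0 ≤ α k) → (∀ k, α k ≤ V) →
      (∀ k, 2 * k₀ ≤ k → α k * k ^ (p - 1) ≤ C * α (k / 2) ^ θ) →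
      ∀ k, 0 < k → k ^ ((p - 1) / (1 - θ)) * α k ≤ M := by
  set γ : ℝ := (p - 1) / (1 - θ) with hγ
  have h1θ : 0 < 1 - θ := by linarith
  have hγ0 : 0 < γ := div_pos (by linarith) h1θ
  have hγe : γ = γ * θ + (p - 1) := by rw [hγ]; field_simp; ring
  set D : ℝ := C * 2 ^ (γ * θ) with hD
  have hD0 : 0 < D := by positivity
  set M : ℝ := max (V * (2 * k₀) ^ γ) (D ^ (1 / (1 - θ))) with hM
  have hMD : D ^ (1 / (1 - θ)) ≤ M := le_max_right _ _
  have hM0 : 0 < M := lt_of_lt_of_le (by positivity) hMD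
  have hfix : D * M ^ θ ≤ M := by
    have h : D ≤ M ^ (1 - θ) := by
      calc D = (D ^ (1 / (1 - θ))) ^ (1 - θ) := by
            rw [← Real.rpow_mul hD0.le, one_div_mul_cancel h1θ.ne', Real.rpow_one]
        _ ≤ _ := by gcongr
    calc D * M ^ θ ≤ M ^ (1 - θ) * M ^ θ := by gcongr
      _ = M := by rw [← Real.rpow_add hM0, sub_add_cancel, Real.rpow_one]
  refine ⟨M, fun α h0 hα hdecay => ?_⟩
  have hsmall : ∀ k, 0 < k → k ≤ 2 * k₀ → k ^ γ * α k ≤ M := fun k hk hkk => by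
    refine le_trans ?_ (le_max_left _ _)
    rw [mul_comm]
    have := h0 k
    gcongr
    exact hα k
  have hind : ∀ i : ℕ, ∀ k, 0 < k → k ≤ 2 ^ i * (2 * k₀) → k ^ γ * α k ≤ M := by
    intro i
    induction i with
    | zero => intro k hk hkk; exact hsmall k hk (by simpa using hkk)
    | succ i ih =>
      intro k hk hkk
      rcases le_total k (2 * k₀) with h | h
      · exact hsmall k hk h
      have hG := ih (k / 2) (by positivity) (by rw [pow_succ] at hkk; linarith)
      have hk2 : k ^ (γ * θ) = 2 ^ (γ * θ) * ((k / 2) ^ γ) ^ θ := by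
        rw [← Real.rpow_mul (by positivity), ← Real.mul_rpow (by norm_num) (by positivity)]
        congr 1; ring
      calc k ^ γ * α k = k ^ (γ * θ) * (α k * k ^ (p - 1)) := by
            conv_lhs => rw [hγe, Real.rpow_add hk]
            ring
        _ ≤ k ^ (γ * θ) * (C * α (k / 2) ^ θ) := 
            mul_le_mul_of_nonneg_left (hdecay k h) (by positivity)
        _ = D * ((k / 2) ^ γ * α (k / 2)) ^ θ := by
            rw [hk2, Real.mul_rpow (by positivity) (h0 _), hD]; ring
        _ ≤ D * M ^ θ := by
            have := h0 (k / 2)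
            gcongr
        _ ≤ M := hfix
  intro k hk
  obtain ⟨i, hi⟩ := pow_unbounded_of_one_lt (k / (2 * k₀)) one_lt_two
  exact hind i k hk ((div_le_iff₀ (by positivity)).1 hi.le)

theorem levelSet_decay (hn : 2 ≤ n) (hs : 0 < s) (hp : 1 < p) {z₀ : Rn n} {ρ : ℝ} (hρ : 0 < ρ)
    {v : Rn n → ℝ} (hv : Measurable v) {C : ℝ} (hC : 0 ≤ C) {k : ℝ} (hk : 0 < k)
    (hT : ∫⁻ x in ball z₀ ρ, ∫⁻ y in ball z₀ ρ, ENNReal.ofReal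
      (|trunc k (v x) - trunc k (v y)| ^ p / ‖x - y‖ ^ ((n : ℝ) + s * p)) ≤ ENNReal.ofReal (k * C))
    (h2 : 2 * volume.real (ball z₀ ρ ∩ {x | k / 2 < |v x|}) ≤ volume.real (ball z₀ ρ)) :
    volume.real (ball z₀ ρ ∩ {x | k < |v x|}) * k ^ (p - 1) ≤
      C * 2 ^ p * (2 ^ ((n : ℝ) + s * p) *
        (2 / volume.real (ball (0 : Rn n) 1)) ^ (((n : ℝ) + s * p) / n)) *
        volume.real (ball z₀ ρ ∩ {x | k / 2 < |v x|}) ^ (s * p / n) := by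
  set N : ℝ := (n : ℝ) + s * p with hN
  have hN0 : 0 < N := by positivity
  have hn0 : (n : ℝ) ≠ 0 := by positivity
  set ω := volume.real (ball (0 : Rn n) 1) with hω
  have hω0 : 0 < ω :=
    ENNReal.toReal_pos (measure_ball_pos _ _ one_pos).ne' measure_ball_lt_top.ne
  have mB : MeasurableSet (ball z₀ ρ) := measurableSet_ball
  set A := ball z₀ ρ ∩ {x | k < |v x|} with hA
  set H := ball z₀ ρ ∩ {x | k / 2 < |v x|} with hH
  have mA : MeasurableSet A := mB.inter (measurableSet_lt measurable_const hv.abs)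
  have mH : MeasurableSet H := mB.inter (measurableSet_lt measurable_const hv.abs)
  have hAH : A ⊆ H := inter_subset_inter_right _ fun x hx => by
    simp only [mem_ofPred_eq] at hx ⊢; linarith
  have hHtop : volume H ≠ ⊤ := (measure_mono inter_subset_left).trans_lt measure_ball_lt_top |>.ne
  have hAtop : volume A ≠ ⊤ := ((measure_mono hAH).trans_lt hHtop.lt_top).ne
  have : Nontrivial (Rn n) := by
    have : Nonempty (Fin n) := ⟨⟨0, by omega⟩⟩
    infer_instance
  have hball : volume.real (ball z₀ ρ) = ρ ^ n * ω := by
    rw [measureReal_def, Measure.addHaar_ball _ _ hρ.le, finrank_euclideanSpace_fin,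
      ENNReal.toReal_mul, ENNReal.toReal_ofReal (by positivity), hω, measureReal_def]
  set h := volume.real H with hh
  rcases (measureReal_nonneg : 0 ≤ volume.real H).eq_or_lt with h0 | h0
  · have : volume.real A = 0 := le_antisymm
      ((measureReal_mono hAH hHtop).trans h0.symm.le) measureReal_nonneg
    rw [this, zero_mul]
    positivity
  rw [← hh] at h0
  set r : ℝ := 2 * (2 * h / ω) ^ (1 / (n : ℝ)) with hr
  have hr0 : 0 < r := by positivity
  have hrn : (r / 2) ^ n = 2 * h / ω := by
    rw [hr, mul_div_cancel_left₀ _ two_ne_zero, ← Real.rpow_natCast,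
      ← Real.rpow_mul (by positivity), one_div_mul_cancel hn0, Real.rpow_one]
  have hrρ : r ≤ 2 * ρ := by
    have : (r / 2) ^ n ≤ ρ ^ n := by
      rw [hrn, div_le_iff₀ hω0, ← hball]; exact h2
    have := (pow_le_pow_iff_left₀ (by positivity) hρ.le (by omega)).1 this
    linarith
  have hrN : r ^ N = 2 ^ N * (2 / ω) ^ (N / n) * (h * h ^ (s * p / n)) := by
    have e : h * h ^ (s * p / n) = h ^ (N / n) := by
      rw [hN, add_div, div_self hn0, Real.rpow_add h0, Real.rpow_one]
    rw [e, hr, Real.mul_rpow (by norm_num) (by positivity), ← Real.rpow_mul (by positivity),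
      mul_assoc, ← Real.mul_rpow (by positivity) h0.le]
    congr 2 <;> ring
  have hH2 : 2 * volume H ≤ ENNReal.ofReal ((r / 2) ^ n) * volume (ball (0 : Rn n) 1) := by
    rw [hrn, ← ofReal_measureReal hHtop, ← ofReal_measureReal measure_ball_lt_top.ne,
      ← ENNReal.ofReal_mul (by positivity), ← hω, div_mul_cancel₀ _ hω0.ne', ← hh,
      ENNReal.ofReal_mul two_pos.le, ENNReal.ofReal_ofNat]
  have key : ENNReal.ofReal ((k / 2) ^ p) * (ENNReal.ofReal (1 / r ^ N) * volume H) * volume A ≤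
      ENNReal.ofReal (k * C) := by
    refine le_trans ?_ hT
    rw [← setLIntegral_const]
    refine (setLIntegral_mono' mA fun x hx => ?_).trans (lintegral_mono_set inter_subset_left)
    refine (mul_le_mul_right
      (le_lintegral_ball_diff hn hN0.le hr0 hrρ hx.1 mH hHtop hH2) _).trans ?_
    rw [← lintegral_const_mul' _ _ ENNReal.ofReal_ne_top]
    refine (setLIntegral_mono' (mB.diff mH) fun y hy => ?_).trans (lintegral_mono_set sdiff_subset)
    rw [← ENNReal.ofReal_mul (by positivity), mul_one_div]
    refine ENNReal.ofReal_le_ofReal (div_le_div_of_nonneg_right ?_ (by positivity))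
    refine Real.rpow_le_rpow (by positivity) (half_le_abs_trunc_sub hk.le hx.2 ?_) (by linarith)
    by_contra hlt
    exact hy.2 ⟨hy.1, not_le.1 hlt⟩
  rw [← ofReal_measureReal hHtop, ← ofReal_measureReal hAtop, ← ENNReal.ofReal_mul (by positivity),
    ← ENNReal.ofReal_mul (by positivity), ← ENNReal.ofReal_mul (by positivity),
    ENNReal.ofReal_le_ofReal_iff (by positivity), ← hh] at key
  set a := volume.real A
  have hkp : k ^ (p - 1) * k = k ^ p := rpow_sub_one_mul_self hk.le hp
  rw [Real.div_rpow hk.le two_pos.le, ← hkp, hrN] at key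
  have hh' : 0 < h ^ (s * p / n) := by positivity
  have h2N : (0 : ℝ) < 2 ^ N * (2 / ω) ^ (N / n) := by positivity
  have h2p : (0 : ℝ) < 2 ^ p := by positivity
  generalize (2 : ℝ) ^ N * (2 / ω) ^ (N / n) = c at *
  generalize h ^ (s * p / n) = t at *
  generalize (2 : ℝ) ^ p = b at *
  have e : k ^ (p - 1) * k / b * (1 / (c * (h * t)) * h) * a =
      a * k ^ (p - 1) / (b * c * t) * k := by
    field_simp
  rw [e, mul_comm k C] at key
  have := le_of_mul_le_mul_right key hk
  rw [div_le_iff₀ (by positivity)] at this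
  linarith

theorem exists_levelSet_bound (hn : 2 ≤ n) (hs : 0 < s) (hs1 : s < 1) (hΛ : 1 ≤ Λ)
    (hp : 1 < p) (hsp : s * p < n) (hK : KernelBounds n Λ s p K) (hΦ : PhiBounds Λ p Φ)
    {Ω : Set (Rn n)} {δ q : ℝ} (hδ : 0 < δ) (hδ1 : δ ≤ 1) (hq : (1 + δ) * (p - 1) = q)
    (z₀ : Rn n) {ρ R : ℝ} (hρ : 0 < ρ) (hR : 4 * ρ ≤ R) (hΩ : closedBall z₀ (3 * ρ) ⊆ Ω)
    {A : ℝ≥0∞} (hA : A < ⊤) :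
    ∃ M : ℝ, ∀ v f : Rn n → ℝ, IsBoundedSol n Φ K s p Ω q z₀ R A v f → ∀ k : ℝ, 0 < k →
      k ^ ((n : ℝ) * (p - 1) / ((n : ℝ) - s * p)) *
        volume.real (ball z₀ ρ ∩ {x | k < |v x|}) ≤ M := by
  obtain ⟨C, hC, hCb⟩ :=
    exists_truncation_energy_le hn hs hs1 hΛ hp hK hΦ hδ hδ1 hq z₀ hρ hR hΩ hA
  have hn0 : (0 : ℝ) < n := by positivity
  have hq0 : 0 < q := by
    rw [← hq]; exact mul_pos (by linarith) (by linarith)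
  set V := volume.real (ball z₀ ρ) with hV
  have hV0 : 0 < V := ENNReal.toReal_pos (measure_ball_pos _ _ hρ).ne' measure_ball_lt_top.ne
  set ω := volume.real (ball (0 : Rn n) 1) with hω
  have hω0 : 0 < ω := ENNReal.toReal_pos (measure_ball_pos _ _ one_pos).ne' measure_ball_lt_top.ne
  set k₀ : ℝ := (2 * A.toReal / V + 1) ^ (1 / q) with hk₀
  have hA0 : 0 ≤ A.toReal := ENNReal.toReal_nonneg
  have hk₀0 : 0 < k₀ := by positivity
  have hk₀q : 2 * A.toReal ≤ k₀ ^ q * V := by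
    rw [hk₀, ← Real.rpow_mul (by positivity), one_div_mul_cancel hq0.ne', Real.rpow_one, add_mul,
      div_mul_cancel₀ _ hV0.ne']
    linarith
  have hC0 : 0 ≤ C.toReal := ENNReal.toReal_nonneg
  set D : ℝ := (C.toReal + 1) * 2 ^ p *
    (2 ^ ((n : ℝ) + s * p) * (2 / ω) ^ (((n : ℝ) + s * p) / n)) with hD
  obtain ⟨M, hM⟩ := exists_bound_of_levelSet_decay (V := V) (C := D) (θ := s * p / n) hV0.le hk₀0
    (by positivity) (by positivity) ((div_lt_one hn0).2 hsp) hp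
  have hexp : (p - 1) / (1 - s * p / n) = (n : ℝ) * (p - 1) / ((n : ℝ) - s * p) := by
    have : (n : ℝ) - s * p ≠ 0 := by linarith
    field_simp
  rw [hexp] at hM
  refine ⟨M, fun v f h k hk => hM (fun k => volume.real (ball z₀ ρ ∩ {x | k < |v x|}))
    (fun _ => measureReal_nonneg) (fun k => measureReal_mono inter_subset_left
      measure_ball_lt_top.ne) (fun k hk => ?_) k hk⟩
  have hk0 : 0 < k := by linarith
  have hvm := h.measurable
  refine levelSet_decay hn hs hp hρ hvm (by positivity) hk0 ((hCb v f h k hk0).trans ?_) ?_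
  · rw [ENNReal.ofReal_mul hk0.le]
    refine mul_le_mul_right ?_ _
    exact (ENNReal.ofReal_toReal hC.ne).symm.le.trans (ENNReal.ofReal_le_ofReal (by linarith))
  · set H := ball z₀ ρ ∩ {x | k / 2 < |v x|} with hH
    have hHtop : volume H ≠ ⊤ :=
      ((measure_mono inter_subset_left).trans_lt measure_ball_lt_top).ne
    have h1 : ENNReal.ofReal (k₀ ^ q) * volume H ≤ A := by
      rw [← setLIntegral_const]
      refine (setLIntegral_mono' (measurableSet_ball.inter
        (measurableSet_lt measurable_const hvm.abs)) fun x hx => ?_).trans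
        ((lintegral_mono_set (inter_subset_left.trans (ball_subset_ball (by linarith)))).trans
          h.lintegral_le)
      have : k / 2 < |v x| := hx.2
      exact ENNReal.ofReal_le_ofReal (Real.rpow_le_rpow hk₀0.le (by linarith) hq0.le)
    have h2 : k₀ ^ q * volume.real H ≤ A.toReal := by
      have := ENNReal.toReal_mono hA.ne h1
      rwa [ENNReal.toReal_mul, ENNReal.toReal_ofReal (by positivity)] at this
    have h3 : 0 < k₀ ^ q := by positivity
    refine le_of_mul_le_mul_left ?_ h3
    linarith

theorem lintegral_abs_rpow_div_le {X : Type*} [MeasurableSpace X] {ν : Measure X} {a b w : X → ℝ}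
    {r : ℝ} (hr : 0 ≤ r) (hb : AEMeasurable b ν) (hw : AEMeasurable w ν) (hw0 : ∀ x, 0 ≤ w x) :
    ∫⁻ x, ENNReal.ofReal (|a x| ^ r / w x) ∂ν ≤ ENNReal.ofReal (2 ^ r) *
      (∫⁻ x, ENNReal.ofReal (|a x - b x| ^ r / w x) ∂ν +
        ∫⁻ x, ENNReal.ofReal (|b x| ^ r / w x) ∂ν) := by
  rw [← lintegral_add_right' _ (by fun_prop), ← lintegral_const_mul' _ _ ENNReal.ofReal_ne_top]
  refine lintegral_mono fun x => ?_
  have := hw0 x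
  rw [← ENNReal.ofReal_add (by positivity) (by positivity), ← ENNReal.ofReal_mul (by positivity),
    ← add_div, ← mul_div_assoc]
  refine ENNReal.ofReal_le_ofReal (div_le_div_of_nonneg_right ?_ this)
  simpa using abs_add_rpow_le (a x - b x) (b x) hr

theorem exists_eventually_lintegral_rpow_le {X : Type*} [MeasurableSpace X] {ν : Measure X}
    {a : ℕ → X → ℝ} {b : X → ℝ} {r : ℝ} (hr : 0 ≤ r) (ha : ∀ j, AEMeasurable (a j) ν)
    (hb : AEMeasurable b ν) (hfin : ∀ j, ∫⁻ x, ENNReal.ofReal (|a j x| ^ r) ∂ν < ⊤)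
    (hlim : Tendsto (fun j => ∫⁻ x, ENNReal.ofReal (|a j x - b x| ^ r) ∂ν) atTop (𝓝 0)) :
    ∃ A : ℝ≥0∞, A < ⊤ ∧ ∀ᶠ j in atTop, ∫⁻ x, ENNReal.ofReal (|a j x| ^ r) ∂ν ≤ A := by
  have hev : ∀ᶠ j in atTop, ∫⁻ x, ENNReal.ofReal (|a j x - b x| ^ r) ∂ν < 1 :=
    hlim.eventually_lt_const one_pos
  have hsplit : ∀ a b : X → ℝ, AEMeasurable b ν → ∫⁻ x, ENNReal.ofReal (|a x| ^ r) ∂ν ≤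
      ENNReal.ofReal (2 ^ r) * (∫⁻ x, ENNReal.ofReal (|a x - b x| ^ r) ∂ν +
        ∫⁻ x, ENNReal.ofReal (|b x| ^ r) ∂ν) := fun a b hb => by
    simpa using lintegral_abs_rpow_div_le (a := a) (w := fun _ => 1) hr hb aemeasurable_const
      fun _ => zero_le_one
  obtain ⟨i, hi⟩ := hev.exists
  have hbfin : ∫⁻ x, ENNReal.ofReal (|b x| ^ r) ∂ν < ⊤ := by
    refine (hsplit b (a i) (ha i)).trans_lt (ENNReal.mul_lt_top ENNReal.ofReal_lt_top
      (ENNReal.add_lt_top.2 ⟨?_, hfin i⟩))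
    simp only [abs_sub_comm (b _)]
    exact hi.trans ENNReal.one_lt_top
  refine ⟨ENNReal.ofReal (2 ^ r) * (1 + ∫⁻ x, ENNReal.ofReal (|b x| ^ r) ∂ν),
    ENNReal.mul_lt_top ENNReal.ofReal_lt_top (ENNReal.add_lt_top.2 ⟨ENNReal.one_lt_top, hbfin⟩),
    hev.mono fun j hj => (hsplit (a j) b hb).trans ?_⟩
  gcongr

theorem lintegral_compl_ball_lt_top_of_tailFn_lt_top (hp : 1 < p) {v : Rn n → ℝ} {z : Rn n}
    {r : ℝ} (hr : 0 < r) (h : tailFn n s p v z r < ⊤) :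
    ∫⁻ x in (ball z r)ᶜ, ENNReal.ofReal (|v x| ^ (p - 1) / ‖x - z‖ ^ ((n : ℝ) + s * p)) < ⊤ := by
  have hp' : 0 < 1 / (p - 1) := one_div_pos.2 (by linarith)
  rw [tailFn, ENNReal.rpow_lt_top_iff_of_pos hp'] at h
  by_contra htop
  rw [not_lt, top_le_iff] at htop
  rw [htop, ENNReal.mul_top (by positivity)] at h
  exact lt_irrefl _ h

theorem exists_eventually_tail_le (hp : 1 < p) {a : ℕ → Rn n → ℝ} {g : Rn n → ℝ}
    (hg : AEMeasurable g) {z : Rn n} {R : ℝ} (hR : 0 < R) (hgt : tailFn n s p g z R < ⊤)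
    (hlim : Tendsto (fun j => tailFn n s p (fun x => a j x - g x) z R) atTop (𝓝 0)) :
    ∃ A : ℝ≥0∞, A < ⊤ ∧ ∀ᶠ j in atTop, ∫⁻ x in (ball z R)ᶜ,
      ENNReal.ofReal (|a j x| ^ (p - 1) / ‖x - z‖ ^ ((n : ℝ) + s * p)) ≤ A := by
  have hp' : 0 < 1 / (p - 1) := one_div_pos.2 (by linarith)
  have hc : ENNReal.ofReal (R ^ (s * p)) ≠ 0 := by positivity
  refine ⟨ENNReal.ofReal (2 ^ (p - 1)) * ((ENNReal.ofReal (R ^ (s * p)))⁻¹ +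
    ∫⁻ x in (ball z R)ᶜ, ENNReal.ofReal (|g x| ^ (p - 1) / ‖x - z‖ ^ ((n : ℝ) + s * p))),
    ENNReal.mul_lt_top ENNReal.ofReal_lt_top (ENNReal.add_lt_top.2 ⟨ENNReal.inv_lt_top.2
      hc.bot_lt, lintegral_compl_ball_lt_top_of_tailFn_lt_top hp hR hgt⟩), ?_⟩
  filter_upwards [hlim.eventually_lt_const one_pos] with j hj
  refine (lintegral_abs_rpow_div_le (by linarith) hg.restrict
    (Measurable.aemeasurable (by fun_prop)) fun _ => by positivity).trans ?_
  gcongr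
  rw [ENNReal.le_inv_iff_mul_le, mul_comm]
  exact le_of_not_gt fun h => hj.not_ge (ENNReal.one_le_rpow h.le hp')

theorem nonlocalForm_congr_ae {v v' : Rn n → ℝ} (h : v =ᵐ[volume] v') (φ : Rn n → ℝ) :
    nonlocalForm n Φ K v φ = nonlocalForm n Φ K v' φ := by
  refine integral_congr_ae (h.mono fun x hx => integral_congr_ae (h.mono fun y hy => ?_))
  dsimp only
  rw [hx, hy]

theorem exists_eventually_isBoundedSol (hp : 1 < p) {Ω : Set (Rn n)} {μ : SignedMeasure (Rn n)}
    {g u : Rn n → ℝ} {uj μj gj : ℕ → Rn n → ℝ}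
    (h : SOLAApprox n Φ K s p Ω μ g u uj μj gj) (hg : BoundaryDatum n s p g) {q : ℝ}
    (hq : qStar p ≤ q) (hq' : q < qBar n s p) (z₀ : Rn n) {R : ℝ} (hR : 0 < R)
    (hΩ : Ω ⊆ ball z₀ R) :
    ∃ A : ℝ≥0∞, A < ⊤ ∧ ∀ᶠ j in atTop, ∃ v : Rn n → ℝ, v =ᵐ[volume] uj j ∧
      IsBoundedSol n Φ K s p Ω q z₀ R A v (μj j) := by
  obtain ⟨hμ, -, hweak, hae, hLq, -, hmass, hgj⟩ := h
  have hq0 : 0 ≤ q := zero_le_one.trans ((le_max_left _ _).trans hq)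
  have hqp : q ≤ p := hq'.le.trans (min_le_right _ _)
  have hum : ∀ j, AEMeasurable (uj j) := fun j => by simpa using (hweak j).1.1
  have hup : ∀ j, ∫⁻ x, ENNReal.ofReal (|uj j x| ^ p) < ⊤ := fun j => by
    simpa using (hweak j).1.2.1
  have hfin : ∀ j, ∫⁻ x in ball z₀ R, ENNReal.ofReal (|uj j x| ^ q) < ⊤ := fun j => by
    calc ∫⁻ x in ball z₀ R, ENNReal.ofReal (|uj j x| ^ q)
        ≤ ∫⁻ x in ball z₀ R, (1 + ENNReal.ofReal (|uj j x| ^ p)) := by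
          refine lintegral_mono fun x => ?_
          rw [← ENNReal.ofReal_one, ← ENNReal.ofReal_add zero_le_one (by positivity)]
          refine ENNReal.ofReal_le_ofReal ?_
          rcases le_total (|uj j x|) 1 with h1 | h1
          · exact (Real.rpow_le_one (abs_nonneg _) h1 hq0).trans
              (le_add_of_nonneg_right (by positivity))
          · exact (Real.rpow_le_rpow_of_exponent_le h1 hqp).trans
              (le_add_of_nonneg_left zero_le_one)
      _ = volume (ball z₀ R) + ∫⁻ x in ball z₀ R, ENNReal.ofReal (|uj j x| ^ p) := by
          rw [lintegral_add_left measurable_const, setLIntegral_one]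
      _ < ⊤ := ENNReal.add_lt_top.2
          ⟨measure_ball_lt_top, (setLIntegral_le_lintegral _ _).trans_lt (hup j)⟩
  obtain ⟨A₁, hA₁, h₁⟩ := exists_eventually_lintegral_rpow_le (ν := volume.restrict (ball z₀ R))
    hq0 (fun j => (hum j).restrict) (aemeasurable_of_tendsto_metrizable_ae atTop hum hae).restrict
    hfin (hLq q hq hq' z₀ R hR)
  obtain ⟨A₂, hA₂, h₂⟩ := exists_eventually_tail_le hp hg.2.1 hR (hg.2.2.2 z₀ R hR) (hgj z₀ R hR).2
  have hA₃ : μ.totalVariation (closedBall z₀ R) + 1 < ⊤ :=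
    ENNReal.add_lt_top.2 ⟨measure_lt_top _ _, ENNReal.one_lt_top⟩
  have h₃ : ∀ᶠ j in atTop, ∫⁻ x in ball z₀ R, ENNReal.ofReal |μj j x| <
      μ.totalVariation (closedBall z₀ R) + 1 :=
    eventually_lt_of_limsup_lt ((hmass z₀ R hR).trans_lt
      (ENNReal.lt_add_right (measure_lt_top _ _).ne one_ne_zero))
  refine ⟨A₁ + A₂ + (μ.totalVariation (closedBall z₀ R) + 1),
    ENNReal.add_lt_top.2 ⟨ENNReal.add_lt_top.2 ⟨hA₁, hA₂⟩, hA₃⟩, ?_⟩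
  filter_upwards [h₁, h₂, h₃] with j hj₁ hj₂ hj₃
  have hv : (hum j).mk (uj j) =ᵐ[volume] uj j := (hum j).ae_eq_mk.symm
  refine ⟨(hum j).mk (uj j), hv, (hum j).measurable_mk, ?_, ?_, (hμ j).1.continuous, (hμ j).2,
    fun φ hφ => (nonlocalForm_congr_ae hv φ).trans ((hweak j).2.2 φ hφ), ?_, ?_, ?_⟩
  · rw [← gagliardo_univ (hum j).measurable_mk]
    refine lt_of_le_of_lt (le_of_eq ?_) (hweak j).1.2.2
    simp only [gagliardo, Measure.restrict_univ]
    refine lintegral_congr_ae (hv.mono fun x hx => lintegral_congr_ae (hv.mono fun y hy => ?_))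
    dsimp only
    rw [hx, hy]
  · refine lt_of_le_of_lt (le_of_eq (lintegral_congr_ae (hv.mono fun x hx => ?_))) (hup j)
    dsimp only
    rw [hx]
  · refine le_trans (le_of_eq (lintegral_congr_ae (ae_restrict_of_ae (hv.mono fun x hx => ?_))))
      (hj₁.trans (le_self_add.trans le_self_add))
    dsimp only
    rw [hx]
  · refine le_trans (le_of_eq (setLIntegral_congr_fun_ae measurableSet_ball.compl ?_))
      (hj₂.trans (le_add_self.trans le_self_add))
    filter_upwards [hv, (hweak j).2.1] with x hx hxg hxR
    rw [hx, hxg fun hxΩ => hxR (hΩ hxΩ)]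
  · exact hj₃.le.trans le_add_self

theorem measure_inter_abs_gt_le_of_tendsto_ae {X : Type*} [MeasurableSpace X] {ν : Measure X}
    {a : ℕ → X → ℝ} {b : X → ℝ} (hab : ∀ᵐ x ∂ν, Tendsto (fun j => a j x) atTop (𝓝 (b x)))
    {S : Set X} {k : ℝ} {C : ℝ≥0∞} (hC : ∀ᶠ j in atTop, ν (S ∩ {x | k < |a j x|}) ≤ C) :
    ν (S ∩ {x | k < |b x|}) ≤ C := by
  set E : ℕ → Set X := fun m => {x | x ∈ S ∧ ∀ j, m ≤ j → k < |a j x|} with hE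
  have hmono : Monotone E := fun m m' hm x hx => ⟨hx.1, fun j hj => hx.2 j (hm.trans hj)⟩
  have hle : ν (S ∩ {x | k < |b x|}) ≤ ν (⋃ m, E m) := by
    refine measure_mono_ae (hab.mono fun x hx hxS => ?_)
    obtain ⟨m, hm⟩ := eventually_atTop.1 (hx.abs.eventually_const_lt hxS.2)
    exact mem_iUnion.2 ⟨m, hxS.1, hm⟩
  refine hle.trans ?_
  rw [hmono.measure_iUnion]
  refine iSup_le fun m => ?_
  obtain ⟨j, hj, hmj⟩ := (hC.and (eventually_ge_atTop m)).exists
  exact (measure_mono (show E m ⊆ S ∩ {x | k < |a j x|} from fun x hx =>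
    ⟨hx.1, hx.2 j hmj⟩)).trans hj

theorem exists_exponent (hn : 2 ≤ n) (hs : 0 < s) (hs1 : s < 1) (hp : 2 - s / (n : ℝ) < p) :
    ∃ δ q : ℝ, 0 < δ ∧ δ ≤ 1 ∧ (1 + δ) * (p - 1) = q ∧ qStar p ≤ q ∧ q < qBar n s p := by
  have hn2 : (2 : ℝ) ≤ n := by exact_mod_cast hn
  have hn0 : (0 : ℝ) < n := by linarith
  have hns : 0 < (n : ℝ) - s := by linarith
  have hp' : (n : ℝ) - s < n * (p - 1) := by
    have : s / n * n = s := div_mul_cancel₀ _ hn0.ne'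
    nlinarith
  have hp1 : 0 < p - 1 := by
    by_contra h
    nlinarith
  have hlt : qStar p < qBar n s p := by
    refine max_lt (lt_min ?_ (by linarith)) (lt_min ?_ (by linarith))
    · rwa [one_lt_div hns]
    · rw [lt_div_iff₀ hns]; nlinarith
  obtain ⟨q, hq, hq'⟩ := exists_between hlt
  have h1 : p - 1 < q := (le_max_right _ _).trans_lt hq
  have h2 : q < n * (p - 1) / (n - s) := hq'.trans_le (min_le_left _ _)
  refine ⟨q / (p - 1) - 1, q, ?_, ?_, ?_, hq.le, hq'⟩
  · rw [sub_pos, one_lt_div hp1]; exact h1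
  · rw [lt_div_iff₀ hns] at h2
    rw [sub_le_iff_le_add, div_le_iff₀ hp1]
    by_contra hc
    rw [not_le] at hc
    nlinarith
  · field_simp; ring

theorem exists_ball_bound (hn : 2 ≤ n) (hs : 0 < s) (hs1 : s < 1) (hp : 2 - s / (n : ℝ) < p)
    (hΛ : 1 ≤ Λ) (hsp : s * p < n) (hK : KernelBounds n Λ s p K) (hΦ : PhiBounds Λ p Φ)
    {Ω : Set (Rn n)} (hΩo : IsOpen Ω) (hΩb : Bornology.IsBounded Ω) {μ : SignedMeasure (Rn n)}
    {g u : Rn n → ℝ} (hg : BoundaryDatum n s p g) {uj μj gj : ℕ → Rn n → ℝ}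
    (h : SOLAApprox n Φ K s p Ω μ g u uj μj gj) {z : Rn n} (hz : z ∈ Ω) :
    ∃ ρ : ℝ, 0 < ρ ∧ ∃ C : ℝ≥0∞, C < ⊤ ∧ ∀ k : ℝ, 0 ≤ k →
      ENNReal.ofReal k ^ ((n : ℝ) * (p - 1) / ((n : ℝ) - s * p)) *
        volume (ball z ρ ∩ {x | k < |u x|}) ≤ C := by
  obtain ⟨δ, q, hδ, hδ1, hq, hq1, hq2⟩ := exists_exponent hn hs hs1 hp
  have hn0 : (0 : ℝ) < n := by positivity
  have hp1 : 1 < p := by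
    have : s / n < 1 := by
      rw [div_lt_one hn0]
      have : (2 : ℝ) ≤ n := by exact_mod_cast hn
      linarith
    linarith
  obtain ⟨ε, hε, hεΩ⟩ := Metric.isOpen_iff.1 hΩo z hz
  set ρ := ε / 4 with hρ
  have hρ0 : 0 < ρ := by positivity
  obtain ⟨R', hR'⟩ := hΩb.subset_ball z
  set R := max R' (4 * ρ)
  have hR : 4 * ρ ≤ R := le_max_right _ _
  obtain ⟨A, hA, hAb⟩ := exists_eventually_isBoundedSol hp1 h hg hq1 hq2 z
    (hR.trans_lt' (by positivity)) (hR'.trans (ball_subset_ball (le_max_left _ _)))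
  obtain ⟨M, hM⟩ := exists_levelSet_bound hn hs hs1 hΛ hp1 hsp hK hΦ hδ hδ1 hq z hρ0 hR
    ((closedBall_subset_ball (by linarith)).trans hεΩ) hA
  set γ : ℝ := (n : ℝ) * (p - 1) / ((n : ℝ) - s * p) with hγ
  have hγ0 : 0 < γ := div_pos (mul_pos hn0 (by linarith)) (by linarith)
  refine ⟨ρ, hρ0, ENNReal.ofReal M, ENNReal.ofReal_lt_top, fun k hk => ?_⟩
  rcases hk.eq_or_lt with rfl | hk
  · simp [ENNReal.zero_rpow_of_pos hγ0]
  have hkγ : 0 < k ^ γ := by positivity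
  rw [ENNReal.ofReal_rpow_of_pos hk, mul_comm,
    ← ENNReal.le_div_iff_mul_le (Or.inl (by positivity)) (Or.inl ENNReal.ofReal_ne_top),
    ← ENNReal.ofReal_div_of_pos hkγ]
  refine measure_inter_abs_gt_le_of_tendsto_ae h.2.2.2.1 (hAb.mono ?_)
  rintro j ⟨v, hv, hvb⟩
  have hvj : volume (ball z ρ ∩ {x | k < |uj j x|}) = volume (ball z ρ ∩ {x | k < |v x|}) := by
    refine measure_congr (hv.mono fun x hx => ?_)
    exact propext (by change (_ ∧ k < |uj j x|) ↔ (_ ∧ k < |v x|); rw [hx])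
  rw [hvj, ← ofReal_measureReal ((measure_mono inter_subset_left).trans_lt measure_ball_lt_top).ne]
  refine ENNReal.ofReal_le_ofReal ?_
  rw [le_div_iff₀ hkγ, mul_comm]
  exact hM v (μj j) hvb k hk

end

end Marcinkiewicz

/-- Corollary 1.1, Marcinkiewicz estimate. -/
theorem SOLA_marcinkiewicz
    (n : ℕ) (s p Λ : ℝ) (Φ : ℝ → ℝ) (K : Rn n → Rn n → ℝ)
    (Ω : Set (Rn n)) (μ : MeasureTheory.SignedMeasure (Rn n)) (g u : Rn n → ℝ)
    (hn : 2 ≤ n) (hs : 0 < s) (hs1 : s < 1) (hp : 2 - s / (n : ℝ) < p) (hΛ : 1 ≤ Λ)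
    (hsp : s * p < n)
    (hK : KernelBounds n Λ s p K) (hΦ : PhiBounds Λ p Φ)
    (hΩo : IsOpen Ω) (hΩb : Bornology.IsBounded Ω)
    (hg : BoundaryDatum n s p g)
    (hu : IsSOLA n Φ K s p Ω μ g u) :
    ∀ Ω' : Set (Rn n), IsOpen Ω' → IsCompact (closure Ω') → closure Ω' ⊆ Ω →
      ∃ C : ℝ≥0∞, C < ⊤ ∧
        ∀ lam : ℝ, 0 ≤ lam →
          ENNReal.ofReal lam ^ ((n : ℝ) * (p - 1) / ((n : ℝ) - s * p)) *
              volume {x ∈ Ω' | lam < |u x|} ≤ C := by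
  intro Ω' _ hc hsub
  obtain ⟨uj, μj, gj, happ⟩ := hu.2.2.2
  set γ : ℝ := (n : ℝ) * (p - 1) / ((n : ℝ) - s * p)
  suffices H : ∃ C : ℝ≥0∞, C < ⊤ ∧ ∀ lam : ℝ, 0 ≤ lam →
      ENNReal.ofReal lam ^ γ * volume (closure Ω' ∩ {x | lam < |u x|}) ≤ C by
    obtain ⟨C, hC, hCb⟩ := H
    refine ⟨C, hC, fun lam hlam => le_trans ?_ (hCb lam hlam)⟩
    exact mul_le_mul_right (measure_mono (inter_subset_inter_left _ subset_closure)) _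
  refine hc.induction_on (p := fun S => ∃ C : ℝ≥0∞, C < ⊤ ∧ ∀ lam : ℝ, 0 ≤ lam →
    ENNReal.ofReal lam ^ γ * volume (S ∩ {x | lam < |u x|}) ≤ C)
    ⟨0, ENNReal.zero_lt_top, fun _ _ => by simp⟩ ?_ ?_ ?_
  · rintro S T hST ⟨C, hC, hCb⟩
    exact ⟨C, hC, fun lam hlam => le_trans
      (mul_le_mul_right (measure_mono (inter_subset_inter_left _ hST)) _) (hCb lam hlam)⟩
  · rintro S T ⟨C, hC, hCb⟩ ⟨D, hD, hDb⟩
    refine ⟨C + D, ENNReal.add_lt_top.2 ⟨hC, hD⟩, fun lam hlam => ?_⟩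
    rw [union_inter_distrib_right]
    exact (mul_le_mul_right (measure_union_le _ _) _).trans
      ((mul_add _ _ _).le.trans (add_le_add (hCb lam hlam) (hDb lam hlam)))
  · intro z hz
    obtain ⟨ρ, hρ, H⟩ := Marcinkiewicz.exists_ball_bound hn hs hs1 hp hΛ hsp hK hΦ hΩo hΩb hg happ
      (hsub hz)
    exact ⟨ball z ρ, mem_nhdsWithin_of_mem_nhds (ball_mem_nhds z hρ), H⟩
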